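/- arXiv:2311.05580 — 7 statements merged into one kernel-verified Lean document; each statement's English description precedes it below -/
import Mathlib

section
/- Let M be a PDG and gamma > 0 with beta_a >= 0 and beta_a >= gamma·alpha_a for every a in A. Then ⟨M⟩_gamma is gamma-strongly convex with respect to the ℓ1 norm on joint distributions: for all joint distributions mu_1, mu_2 with ⟨M⟩_gamma(mu_1) < +infinity and ⟨M⟩_gamma(mu_2) < +infinity, and all lambda in [0,1], ⟨M⟩_gamma((1−lambda)·mu_1 + lambda·mu_2) <= (1−lambda)·⟨M⟩_gamma(mu_1) + lambda·⟨M⟩_gamma(mu_2) − (gamma/2)·lambda·(1−lambda)·( sum_w |mu_1(w) − mu_2(w)| )². In particular, ⟨M⟩_gamma has at most one minimizer among joint distributions of finite score. -/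
open Finset

section PDGSetup

variable {I : Type} [Fintype I] [DecidableEq I]
variable {X : I → Type} [∀ i, Fintype (X i)] [∀ i, DecidableEq (X i)] [∀ i, Nonempty (X i)]

/-- `μ` is a joint distribution on worlds: nonnegative and summing to one. -/
def IsDist (μ : (∀ i, X i) → ℝ) : Prop := (∀ w, 0 ≤ μ w) ∧ ∑ w, μ w = 1

/-- Restriction of a world `w` to the variables in `S`. -/
def restr (w : ∀ i, X i) (S : Finset I) : ∀ i : S, X i.1 := fun i => w i.1

/-- The marginal probability `μ(S = s)`. -/
def marg (μ : (∀ i, X i) → ℝ) (S : Finset I) (s : ∀ i : S, X i.1) : ℝ :=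
  ∑ w, if restr w S = s then μ w else 0

/-- The joint marginal probability `μ(S = s, T = t)`. -/
def marg2 (μ : (∀ i, X i) → ℝ) (S T : Finset I) (s : ∀ i : S, X i.1) (t : ∀ i : T, X i.1) : ℝ :=
  ∑ w, if restr w S = s ∧ restr w T = t then μ w else 0

/-- A probabilistic dependency graph over variables `I` with value types `X`. -/
structure PDG (I : Type) (X : I → Type) [Fintype I] [DecidableEq I]
    [∀ i, Fintype (X i)] [∀ i, DecidableEq (X i)] where
  /-- the (finite) type of arcs -/
  A : Type
  [fintA : Fintype A]
  Src : A → Finset I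
  Tgt : A → Finset I
  disj : ∀ a, Disjoint (Src a) (Tgt a)
  /-- the cpd `p_a(t|s)` attached to arc `a` -/
  cpd : ∀ a, (∀ i : Src a, X i.1) → (∀ i : Tgt a, X i.1) → ℝ
  cpd_nonneg : ∀ a s t, 0 ≤ cpd a s t
  cpd_sum : ∀ a s, ∑ t, cpd a s t = 1
  alpha : A → ℝ
  beta : A → ℝ

attribute [instance] PDG.fintA

/-- The entropy `H(μ)` (convention `0·log 0 = 0`, automatic since `Real.log 0 = 0`). -/
noncomputable def entropy (μ : (∀ i, X i) → ℝ) : ℝ := -∑ w, μ w * Real.log (μ w)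

/-- The conditional entropy `H_μ(T | S)`. -/
noncomputable def condEnt (μ : (∀ i, X i) → ℝ) (S T : Finset I) : ℝ :=
  -∑ s, ∑ t, marg2 μ S T s t * Real.log (marg2 μ S T s t / marg μ S s)

/-- The structural incompatibility `SInc_M(μ)`. -/
noncomputable def SInc (M : PDG I X) (μ : (∀ i, X i) → ℝ) : ℝ :=
  (∑ a, M.alpha a * condEnt μ (M.Src a) (M.Tgt a)) - entropy μ

/-- One term `m·log(m/q)` of `OInc`, with the conventions `0·log 0 = 0`,
`0·log(0/x) = 0`, and `y·log(y/0) = +∞` for `y > 0`. -/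
noncomputable def oterm (m q : ℝ) : EReal :=
  if m = 0 then 0 else if q = 0 then ⊤ else ((m * Real.log (m / q) : ℝ) : EReal)

/-- The observational incompatibility `OInc_M(μ)`, valued in the extended reals. -/
noncomputable def OInc (M : PDG I X) (μ : (∀ i, X i) → ℝ) : EReal :=
  ∑ a, (M.beta a : EReal) *
    ∑ s, ∑ t, oterm (marg2 μ (M.Src a) (M.Tgt a) s t) (M.cpd a s t * marg μ (M.Src a) s)

/-- The γ-score `⟨M⟩_γ(μ) = OInc_M(μ) + γ·SInc_M(μ)`. -/
noncomputable def score (M : PDG I X) (γ : ℝ) (μ : (∀ i, X i) → ℝ) : EReal :=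
  OInc M μ + ((γ * SInc M μ : ℝ) : EReal)

end PDGSetup

/-! ### Scalar inequalities -/

lemma pinsker_deriv (t : ℝ) (ht : 0 < t) :
    HasDerivAt (fun t : ℝ => Real.log t - (5 * t ^ 2 - 4 * t - 1) / (2 * t ^ 2 + 4 * t))
      (4 * (t - 1) ^ 3 / (2 * t ^ 2 + 4 * t) ^ 2) t := by
  have hD : (2 * t ^ 2 + 4 * t) ≠ 0 := by positivity
  have hN : HasDerivAt (fun t : ℝ => 5 * t ^ 2 - 4 * t - 1) (10 * t - 4) t := by
    have h := (((hasDerivAt_pow 2 t).const_mul 5).sub ((hasDerivAt_id t).const_mul 4)).sub_const 1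
    refine HasDerivAt.congr_deriv (f := _) h ?_
    norm_num
    try ring
  have hDd : HasDerivAt (fun t : ℝ => 2 * t ^ 2 + 4 * t) (4 * t + 4) t := by
    have h := (((hasDerivAt_pow 2 t).const_mul 2).add ((hasDerivAt_id t).const_mul 4))
    refine HasDerivAt.congr_deriv (f := _) h ?_
    norm_num
    try ring
  have h := (Real.hasDerivAt_log ht.ne').sub (hN.div hDd hD)
  refine HasDerivAt.congr_deriv h ?_
  field_simp
  ring

lemma pinsker_log (t : ℝ) (ht : 0 < t) :
    (5 * t ^ 2 - 4 * t - 1) / (2 * t ^ 2 + 4 * t) ≤ Real.log t := by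
  set F : ℝ → ℝ := fun t => Real.log t - (5 * t ^ 2 - 4 * t - 1) / (2 * t ^ 2 + 4 * t) with hF
  have hF1 : F 1 = 0 := by simp [hF]; norm_num
  have key : F 1 ≤ F t := by
    rcases le_total t 1 with h | h
    · have hanti : AntitoneOn F (Set.Icc t 1) := by
        apply antitoneOn_of_deriv_nonpos (convex_Icc t 1)
        · intro x hx
          exact (pinsker_deriv x (lt_of_lt_of_le ht hx.1)).continuousAt.continuousWithinAt
        · intro x hx
          rw [interior_Icc] at hx
          exact (pinsker_deriv x (ht.trans hx.1)).differentiableAt.differentiableWithinAt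
        · intro x hx
          rw [interior_Icc] at hx
          rw [(pinsker_deriv x (ht.trans hx.1)).deriv]
          apply div_nonpos_of_nonpos_of_nonneg
          · have : (x - 1) ^ 3 ≤ 0 := Odd.pow_nonpos (by decide) (by linarith [hx.2])
            linarith
          · positivity
      exact hanti (Set.left_mem_Icc.2 h) (Set.right_mem_Icc.2 h) h
    · have hmono : MonotoneOn F (Set.Icc 1 t) := by
        apply monotoneOn_of_deriv_nonneg (convex_Icc 1 t)
        · intro x hx
          exact (pinsker_deriv x (lt_of_lt_of_le one_pos hx.1)).continuousAt.continuousWithinAt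
        · intro x hx
          rw [interior_Icc] at hx
          exact (pinsker_deriv x (one_pos.trans hx.1)).differentiableAt.differentiableWithinAt
        · intro x hx
          rw [interior_Icc] at hx
          rw [(pinsker_deriv x (one_pos.trans hx.1)).deriv]
          have : 0 ≤ x - 1 := by linarith [hx.1]
          positivity
      exact hmono (Set.left_mem_Icc.2 h) (Set.right_mem_Icc.2 h) h
  rw [hF1] at key
  simp only [hF] at key
  linarith

lemma pinsker_scalar (x y : ℝ) (hx : 0 ≤ x) (hy : 0 ≤ y) (hxy : y = 0 → x = 0) :
    3 / 2 * ((x - y) ^ 2 / (x + 2 * y)) ≤ x * Real.log x - x * Real.log y - x + y := by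
  rcases hy.eq_or_lt with h | hy
  · have := hxy h.symm
    subst h; subst this; simp
  rcases hx.eq_or_lt with h | hx
  · subst h
    have : 3 / 2 * ((0 - y) ^ 2 / (0 + 2 * y)) = 3 / 4 * y := by field_simp; ring
    rw [this]; simp; linarith
  have h := mul_le_mul_of_nonneg_left (pinsker_log (x / y) (by positivity)) hx.le
  rw [Real.log_div hx.ne' hy.ne'] at h
  have e : x * ((5 * (x / y) ^ 2 - 4 * (x / y) - 1) / (2 * (x / y) ^ 2 + 4 * (x / y)))
      = 3 / 2 * ((x - y) ^ 2 / (x + 2 * y)) + x - y := by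
    field_simp
    ring
  rw [e] at h
  linarith

lemma pinsker_sum {W : Type*} [Fintype W] (x y : W → ℝ) (hx : ∀ w, 0 ≤ x w) (hy : ∀ w, 0 ≤ y w)
    (hxy : ∀ w, y w = 0 → x w = 0) (sx : ∑ w, x w = 1) (sy : ∑ w, y w = 1) :
    1 / 2 * (∑ w, |x w - y w|) ^ 2 ≤ ∑ w, (x w * Real.log (x w) - x w * Real.log (y w)) := by
  have h1 : 3 / 2 * ∑ w, (x w - y w) ^ 2 / (x w + 2 * y w)
      ≤ ∑ w, (x w * Real.log (x w) - x w * Real.log (y w)) := by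
    have : ∑ w, (x w * Real.log (x w) - x w * Real.log (y w)) =
        ∑ w, (x w * Real.log (x w) - x w * Real.log (y w) - x w + y w) := by
      rw [Finset.sum_add_distrib, Finset.sum_sub_distrib _ x, sx, sy]; ring
    rw [this, Finset.mul_sum]
    exact Finset.sum_le_sum fun w _ => pinsker_scalar _ _ (hx w) (hy w) (hxy w)
  have h2 := Finset.sum_sq_le_sum_mul_sum_of_sq_le_mul (Finset.univ : Finset W)
    (r := fun w => |x w - y w|) (f := fun w => (x w - y w) ^ 2 / (x w + 2 * y w))
    (g := fun w => x w + 2 * y w)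
    (fun w _ => div_nonneg (sq_nonneg _) (by linarith [hx w, hy w]))
    (fun w _ => by linarith [hx w, hy w])
    (fun w _ => by
      rw [sq_abs]
      by_cases h : x w + 2 * y w = 0
      · have a : x w = 0 := by linarith [hx w, hy w]
        have b : y w = 0 := by linarith [hx w, hy w]
        simp [a, b]
      · exact (div_mul_cancel₀ _ h).ge)
  have h3 : ∑ w, (x w + 2 * y w) = 3 := by
    rw [Finset.sum_add_distrib, ← Finset.mul_sum, sx, sy]; norm_num
  rw [h3] at h2
  linarith

lemma negent_strong {W : Type*} [Fintype W] (x y : W → ℝ) (hx : ∀ w, 0 ≤ x w) (hy : ∀ w, 0 ≤ y w)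
    (sx : ∑ w, x w = 1) (sy : ∑ w, y w = 1) (l : ℝ) (h0 : 0 ≤ l) (h1 : l ≤ 1) :
    ∑ w, ((1 - l) * x w + l * y w) * Real.log ((1 - l) * x w + l * y w)
      + 1 / 2 * l * (1 - l) * (∑ w, |x w - y w|) ^ 2 ≤
    (1 - l) * ∑ w, x w * Real.log (x w) + l * ∑ w, y w * Real.log (y w) := by
  rcases h0.eq_or_lt with h | h0
  · subst h; simp
  rcases h1.eq_or_lt with h | h1
  · subst h; simp
  have h1' : 0 < 1 - l := by linarith
  set z : W → ℝ := fun w => (1 - l) * x w + l * y w with hz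
  have hz0 : ∀ w, 0 ≤ z w := fun w =>
    add_nonneg (mul_nonneg h1'.le (hx w)) (mul_nonneg h0.le (hy w))
  have sz : ∑ w, z w = 1 := by
    simp only [hz]
    rw [Finset.sum_add_distrib, ← Finset.mul_sum, ← Finset.mul_sum, sx, sy]; ring
  have zx : ∀ w, z w = 0 → x w = 0 := fun w h => by
    have a := mul_nonneg h1'.le (hx w)
    have b := mul_nonneg h0.le (hy w)
    have : (1 - l) * x w = 0 := by simp only [hz] at h; linarith
    exact (mul_eq_zero.1 this).resolve_left h1'.ne'
  have zy : ∀ w, z w = 0 → y w = 0 := fun w h => by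
    have a := mul_nonneg h1'.le (hx w)
    have b := mul_nonneg h0.le (hy w)
    have : l * y w = 0 := by simp only [hz] at h; linarith
    exact (mul_eq_zero.1 this).resolve_left h0.ne'
  have px := pinsker_sum x z hx hz0 zx sx sz
  have py := pinsker_sum y z hy hz0 zy sy sz
  have ex : ∑ w, |x w - z w| = l * ∑ w, |x w - y w| := by
    rw [Finset.mul_sum]
    refine Finset.sum_congr rfl fun w _ => ?_
    rw [← abs_of_pos h0, ← abs_mul]
    congr 1; simp only [hz]; ring
  have ey : ∑ w, |y w - z w| = (1 - l) * ∑ w, |x w - y w| := by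
    rw [Finset.mul_sum]
    refine Finset.sum_congr rfl fun w _ => ?_
    rw [abs_sub_comm, ← abs_of_pos h1', ← abs_mul]
    congr 1; simp only [hz]; ring
  rw [ex, Finset.sum_sub_distrib] at px
  rw [ey, Finset.sum_sub_distrib] at py
  have ez : ∑ w, z w * Real.log (z w) =
      (1 - l) * ∑ w, x w * Real.log (z w) + l * ∑ w, y w * Real.log (z w) := by
    rw [Finset.mul_sum, Finset.mul_sum, ← Finset.sum_add_distrib]
    refine Finset.sum_congr rfl fun w _ => ?_
    simp only [hz]; ring
  have qx := mul_le_mul_of_nonneg_left px h1'.le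
  have qy := mul_le_mul_of_nonneg_left py h0.le
  change ∑ w, z w * Real.log (z w) + _ ≤ _
  rw [ez]
  nlinarith [qx, qy]

lemma logsum_tangent (a b c : ℝ) (ha : 0 ≤ a) (hb : 0 ≤ b) (hab : b = 0 → a = 0) (hc : 0 < c) :
    a * Real.log c + a - b * c ≤ a * Real.log (a / b) := by
  rcases ha.eq_or_lt with h | ha
  · subst h; simp; positivity
  have hb : 0 < b := lt_of_le_of_ne hb fun h => ha.ne' (hab h.symm)
  have h := Real.log_le_sub_one_of_pos (show 0 < b * c / a by positivity)
  rw [Real.log_div (by positivity) ha.ne', Real.log_mul hb.ne' hc.ne'] at h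
  rw [Real.log_div ha.ne' hb.ne']
  have h' := mul_le_mul_of_nonneg_left h ha.le
  have e : a * (b * c / a - 1) = b * c - a := by field_simp
  rw [e] at h'
  linarith

lemma logsum (l x1 x2 y1 y2 : ℝ) (h0 : 0 ≤ l) (h1 : l ≤ 1) (hx1 : 0 ≤ x1) (hx2 : 0 ≤ x2)
    (hy1 : 0 ≤ y1) (hy2 : 0 ≤ y2) (e1 : y1 = 0 → x1 = 0) (e2 : y2 = 0 → x2 = 0) :
    ((1 - l) * x1 + l * x2) * Real.log (((1 - l) * x1 + l * x2) / ((1 - l) * y1 + l * y2)) ≤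
      (1 - l) * (x1 * Real.log (x1 / y1)) + l * (x2 * Real.log (x2 / y2)) := by
  have h1' : 0 ≤ 1 - l := by linarith
  have a1 := mul_nonneg h1' hx1
  have a2 := mul_nonneg h0 hx2
  have b1 := mul_nonneg h1' hy1
  have b2 := mul_nonneg h0 hy2
  rcases (add_nonneg a1 a2).eq_or_lt with h | h
  · have c1 : (1 - l) * x1 = 0 := by linarith
    have c2 : l * x2 = 0 := by linarith
    rw [← mul_assoc, ← mul_assoc, c1, c2]; simp
  have hY : 0 < (1 - l) * y1 + l * y2 := by
    refine lt_of_le_of_ne (add_nonneg b1 b2) fun hY => ?_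
    have c1 : (1 - l) * y1 = 0 := by linarith
    have c2 : l * y2 = 0 := by linarith
    have d1 : (1 - l) * x1 = 0 := by
      rcases mul_eq_zero.1 c1 with h | h
      · simp [h]
      · simp [e1 h]
    have d2 : l * x2 = 0 := by
      rcases mul_eq_zero.1 c2 with h | h
      · simp [h]
      · simp [e2 h]
    linarith
  set c := ((1 - l) * x1 + l * x2) / ((1 - l) * y1 + l * y2) with hc
  have hcpos : 0 < c := by positivity
  have t1 := mul_le_mul_of_nonneg_left (logsum_tangent x1 y1 c hx1 hy1 e1 hcpos) h1'
  have t2 := mul_le_mul_of_nonneg_left (logsum_tangent x2 y2 c hx2 hy2 e2 hcpos) h0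
  have e : ((1 - l) * y1 + l * y2) * c = (1 - l) * x1 + l * x2 := by
    rw [hc]; field_simp
  nlinarith [t1, t2, e]

/-! ### Extended-real sums -/

lemma ereal_coe_sum {W : Type*} (s : Finset W) (f : W → ℝ) :
    ((∑ w ∈ s, f w : ℝ) : EReal) = ∑ w ∈ s, (f w : EReal) := by
  classical
  induction s using Finset.induction_on with
  | empty => simp
  | insert a s ha ih => rw [Finset.sum_insert ha, Finset.sum_insert ha, EReal.coe_add, ih]

lemma ereal_sum_ne_bot {W : Type*} (s : Finset W) (f : W → EReal) (h : ∀ w, f w ≠ ⊥) :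
    ∑ w ∈ s, f w ≠ ⊥ := by
  classical
  induction s using Finset.induction_on with
  | empty => simp
  | insert a s ha ih =>
    rw [Finset.sum_insert ha]
    simp [EReal.add_eq_bot_iff, h a, ih]

lemma ereal_sum_eq_top {W : Type*} [Fintype W] (f : W → EReal) (h : ∀ w, f w ≠ ⊥) (w : W)
    (hw : f w = ⊤) : ∑ w, f w = ⊤ := by
  classical
  rw [← Finset.add_sum_erase _ _ (Finset.mem_univ w), hw]
  exact EReal.top_add_of_ne_bot (ereal_sum_ne_bot _ _ h)

lemma oterm_ne_bot (m q : ℝ) : oterm m q ≠ ⊥ := by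
  unfold oterm
  split_ifs <;> simp [-EReal.coe_mul]

/-! ### Marginals -/

section Helpers

variable {I : Type} [Fintype I] [DecidableEq I]
variable {X : I → Type} [∀ i, Fintype (X i)] [∀ i, DecidableEq (X i)]

lemma marg_nonneg (μ : (∀ i, X i) → ℝ) (h : ∀ w, 0 ≤ μ w) (S : Finset I) (s) :
    0 ≤ marg μ S s := by
  unfold marg
  refine Finset.sum_nonneg fun w _ => ?_
  split_ifs
  · exact h w
  · exact le_rfl

lemma marg2_nonneg (μ : (∀ i, X i) → ℝ) (h : ∀ w, 0 ≤ μ w) (S T : Finset I) (s t) :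
    0 ≤ marg2 μ S T s t := by
  unfold marg2
  refine Finset.sum_nonneg fun w _ => ?_
  split_ifs
  · exact h w
  · exact le_rfl

lemma marg2_le (μ : (∀ i, X i) → ℝ) (h : ∀ w, 0 ≤ μ w) (S T : Finset I) (s t) :
    marg2 μ S T s t ≤ marg μ S s := by
  unfold marg2 marg
  refine Finset.sum_le_sum fun w _ => ?_
  have := h w
  split_ifs <;> first | exact le_rfl | exact this | tauto

lemma marg2_zero (μ : (∀ i, X i) → ℝ) (h : ∀ w, 0 ≤ μ w) (S T : Finset I) (s t)
    (h0 : marg μ S s = 0) : marg2 μ S T s t = 0 :=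
  le_antisymm (h0 ▸ marg2_le μ h S T s t) (marg2_nonneg μ h S T s t)

lemma marg_mix (μ ν : (∀ i, X i) → ℝ) (l : ℝ) (S : Finset I) (s) :
    marg (fun w => (1 - l) * μ w + l * ν w) S s = (1 - l) * marg μ S s + l * marg ν S s := by
  unfold marg
  rw [Finset.mul_sum, Finset.mul_sum, ← Finset.sum_add_distrib]
  refine Finset.sum_congr rfl fun w _ => ?_
  split_ifs <;> simp

lemma marg2_mix (μ ν : (∀ i, X i) → ℝ) (l : ℝ) (S T : Finset I) (s t) :
    marg2 (fun w => (1 - l) * μ w + l * ν w) S T s t =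
      (1 - l) * marg2 μ S T s t + l * marg2 ν S T s t := by
  unfold marg2
  rw [Finset.mul_sum, Finset.mul_sum, ← Finset.sum_add_distrib]
  refine Finset.sum_congr rfl fun w _ => ?_
  split_ifs <;> simp

lemma isDist_mix (μ ν : (∀ i, X i) → ℝ) (l : ℝ) (h0 : 0 ≤ l) (h1 : l ≤ 1) (hμ : IsDist μ)
    (hν : IsDist ν) : IsDist (fun w => (1 - l) * μ w + l * ν w) := by
  refine ⟨fun w => add_nonneg (mul_nonneg (by linarith) (hμ.1 w)) (mul_nonneg h0 (hν.1 w)), ?_⟩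
  rw [Finset.sum_add_distrib, ← Finset.mul_sum, ← Finset.mul_sum, hμ.2, hν.2]; ring

lemma condEnt_concave (μ ν : (∀ i, X i) → ℝ) (l : ℝ) (h0 : 0 ≤ l) (h1 : l ≤ 1)
    (hμ : ∀ w, 0 ≤ μ w) (hν : ∀ w, 0 ≤ ν w) (S T : Finset I) :
    -condEnt (fun w => (1 - l) * μ w + l * ν w) S T ≤
      (1 - l) * -condEnt μ S T + l * -condEnt ν S T := by
  unfold condEnt
  simp only [neg_neg, Finset.mul_sum, ← Finset.sum_add_distrib]
  refine Finset.sum_le_sum fun s _ => Finset.sum_le_sum fun t _ => ?_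
  rw [marg2_mix, marg_mix]
  exact logsum l _ _ _ _ h0 h1 (marg2_nonneg μ hμ _ _ _ _) (marg2_nonneg ν hν _ _ _ _)
    (marg_nonneg μ hμ _ _) (marg_nonneg ν hν _ _) (marg2_zero μ hμ _ _ _ _)
    (marg2_zero ν hν _ _ _ _)

/-! ### The score as a real number -/

/-- Absolute continuity along arcs of positive weight. -/
def Admis (M : PDG I X) (μ : (∀ i, X i) → ℝ) : Prop :=
  ∀ a s t, M.beta a ≠ 0 → M.cpd a s t = 0 → marg2 μ (M.Src a) (M.Tgt a) s t = 0

/-- The expected log-cpd of an arc. -/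
noncomputable def linPart (M : PDG I X) (μ : (∀ i, X i) → ℝ) (a : M.A) : ℝ :=
  ∑ s, ∑ t, marg2 μ (M.Src a) (M.Tgt a) s t * Real.log (M.cpd a s t)

/-- The real-valued score. -/
noncomputable def rscore (M : PDG I X) (γ : ℝ) (μ : (∀ i, X i) → ℝ) : ℝ :=
  (∑ a, ((M.beta a - γ * M.alpha a) * -condEnt μ (M.Src a) (M.Tgt a)
    - M.beta a * linPart M μ a)) + γ * ∑ w, μ w * Real.log (μ w)

lemma oterm_eq (μ : (∀ i, X i) → ℝ) (hμ : ∀ w, 0 ≤ μ w) (S T : Finset I) (s t) (p : ℝ)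
    (hp : p = 0 → marg2 μ S T s t = 0) :
    oterm (marg2 μ S T s t) (p * marg μ S s) =
      ((marg2 μ S T s t * Real.log (marg2 μ S T s t / marg μ S s)
        - marg2 μ S T s t * Real.log p : ℝ) : EReal) := by
  unfold oterm
  by_cases hm : marg2 μ S T s t = 0
  · simp [hm]
  have hp' : p ≠ 0 := fun h => hm (hp h)
  have hS : marg μ S s ≠ 0 := fun h => hm (marg2_zero μ hμ S T s t h)
  rw [if_neg hm, if_neg (mul_ne_zero hp' hS)]
  congr 1
  rw [Real.log_div hm (mul_ne_zero hp' hS), Real.log_mul hp' hS, Real.log_div hm hS]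
  ring

lemma score_eq (M : PDG I X) (γ : ℝ) (μ : (∀ i, X i) → ℝ) (hμ : ∀ w, 0 ≤ μ w)
    (had : Admis M μ) : score M γ μ = ((rscore M γ μ : ℝ) : EReal) := by
  have hO : OInc M μ = ((∑ a, M.beta a * (-condEnt μ (M.Src a) (M.Tgt a) - linPart M μ a) : ℝ)
      : EReal) := by
    unfold OInc
    rw [ereal_coe_sum]
    refine Finset.sum_congr rfl fun a _ => ?_
    by_cases hb : M.beta a = 0
    · simp [hb]
    rw [EReal.coe_mul]
    congr 1
    unfold condEnt linPart
    rw [neg_neg, ← Finset.sum_sub_distrib, ereal_coe_sum]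
    refine Finset.sum_congr rfl fun s _ => ?_
    rw [← Finset.sum_sub_distrib, ereal_coe_sum]
    refine Finset.sum_congr rfl fun t _ => ?_
    exact oterm_eq μ hμ _ _ s t _ (had a s t hb)
  unfold score
  rw [hO, ← EReal.coe_add]
  congr 1
  unfold rscore SInc entropy
  rw [sub_neg_eq_add, mul_add, ← add_assoc, Finset.mul_sum, ← Finset.sum_add_distrib]
  congr 1
  refine Finset.sum_congr rfl fun a _ => ?_
  ring

lemma admis_of_lt_top (M : PDG I X) (γ : ℝ) (hβ : ∀ a, 0 ≤ M.beta a) (μ : (∀ i, X i) → ℝ)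
    (h : score M γ μ < ⊤) : Admis M μ := by
  intro a s t hb hp
  by_contra hm
  refine h.ne ?_
  have nb : ∀ a, ∑ s, ∑ t, oterm (marg2 μ (M.Src a) (M.Tgt a) s t)
      (M.cpd a s t * marg μ (M.Src a) s) ≠ ⊥ := fun a =>
    ereal_sum_ne_bot _ _ fun s => ereal_sum_ne_bot _ _ fun t => oterm_ne_bot _ _
  have hO : OInc M μ = ⊤ := by
    unfold OInc
    refine ereal_sum_eq_top _ (fun a => ?_) a ?_
    · rcases (hβ a).eq_or_lt with h0 | h0
      · simp [← h0]
      · have := nb a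
        revert this
        generalize (∑ s, ∑ t, oterm (marg2 μ (M.Src a) (M.Tgt a) s t)
          (M.cpd a s t * marg μ (M.Src a) s)) = z
        intro hz
        induction z with
        | bot => exact absurd rfl hz
        | top => rw [EReal.coe_mul_top_of_pos h0]; simp
        | coe r => rw [← EReal.coe_mul]; exact EReal.coe_ne_bot _
    · have : ∑ s, ∑ t, oterm (marg2 μ (M.Src a) (M.Tgt a) s t)
          (M.cpd a s t * marg μ (M.Src a) s) = ⊤ := by
        refine ereal_sum_eq_top _ (fun s => ereal_sum_ne_bot _ _ fun t => oterm_ne_bot _ _) s ?_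
        refine ereal_sum_eq_top _ (fun t => oterm_ne_bot _ _) t ?_
        simp [oterm, hm, hp]
      rw [this]
      exact EReal.coe_mul_top_of_pos (lt_of_le_of_ne (hβ a) (Ne.symm hb))
  unfold score
  rw [hO]
  exact EReal.top_add_coe _

lemma rscore_strong (M : PDG I X) (γ : ℝ) (hγ : 0 < γ) (hβγ : ∀ a, γ * M.alpha a ≤ M.beta a)
    (μ ν : (∀ i, X i) → ℝ) (l : ℝ) (h0 : 0 ≤ l) (h1 : l ≤ 1) (hμ : IsDist μ) (hν : IsDist ν) :
    rscore M γ (fun w => (1 - l) * μ w + l * ν w)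
      + (γ / 2) * l * (1 - l) * (∑ w, |μ w - ν w|) ^ 2 ≤
      (1 - l) * rscore M γ μ + l * rscore M γ ν := by
  have hA : ∑ a, ((M.beta a - γ * M.alpha a) *
        -condEnt (fun w => (1 - l) * μ w + l * ν w) (M.Src a) (M.Tgt a)
        - M.beta a * linPart M (fun w => (1 - l) * μ w + l * ν w) a) ≤
      (1 - l) * ∑ a, ((M.beta a - γ * M.alpha a) * -condEnt μ (M.Src a) (M.Tgt a)
        - M.beta a * linPart M μ a) +
      l * ∑ a, ((M.beta a - γ * M.alpha a) * -condEnt ν (M.Src a) (M.Tgt a)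
        - M.beta a * linPart M ν a) := by
    rw [Finset.mul_sum, Finset.mul_sum, ← Finset.sum_add_distrib]
    refine Finset.sum_le_sum fun a _ => ?_
    have hl : linPart M (fun w => (1 - l) * μ w + l * ν w) a =
        (1 - l) * linPart M μ a + l * linPart M ν a := by
      unfold linPart
      simp only [Finset.mul_sum, ← Finset.sum_add_distrib, marg2_mix]
      refine Finset.sum_congr rfl fun s _ => Finset.sum_congr rfl fun t _ => ?_
      ring
    have hc := mul_le_mul_of_nonneg_left
      (condEnt_concave μ ν l h0 h1 hμ.1 hν.1 (M.Src a) (M.Tgt a)) (sub_nonneg.2 (hβγ a))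
    rw [hl]
    linarith
  have hE := mul_le_mul_of_nonneg_left
    (negent_strong μ ν hμ.1 hν.1 hμ.2 hν.2 l h0 h1) hγ.le
  unfold rscore
  linarith

lemma admis_mix (M : PDG I X) (μ ν : (∀ i, X i) → ℝ) (l : ℝ) (hμ : Admis M μ) (hν : Admis M ν) :
    Admis M (fun w => (1 - l) * μ w + l * ν w) := by
  intro a s t hb hp
  rw [marg2_mix, hμ a s t hb hp, hν a s t hb hp]; simp

end Helpers

section Statement8

variable {I : Type} [Fintype I] [DecidableEq I]
variable {X : I → Type} [∀ i, Fintype (X i)] [∀ i, DecidableEq (X i)] [∀ i, Nonempty (X i)]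

/-- `⟨M⟩_γ` is `γ`-strongly convex w.r.t. the ℓ1 norm on joint distributions of finite
score (the subtracted term of the usual formulation is moved to the left-hand side to
avoid extended-real subtraction), and consequently has at most one minimizer among joint
distributions of finite score. -/
theorem stmt8 (M : PDG I X) (γ : ℝ) (hγ : 0 < γ)
    (hβ : ∀ a, 0 ≤ M.beta a) (hβγ : ∀ a, γ * M.alpha a ≤ M.beta a) :
    (∀ (μ₁ μ₂ : (∀ i, X i) → ℝ) (l : ℝ), IsDist μ₁ → IsDist μ₂ →
      score M γ μ₁ < ⊤ → score M γ μ₂ < ⊤ → 0 ≤ l → l ≤ 1 →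
      score M γ (fun w => (1 - l) * μ₁ w + l * μ₂ w) +
          (((γ / 2) * l * (1 - l) * (∑ w, |μ₁ w - μ₂ w|) ^ 2 : ℝ) : EReal) ≤
        ((1 - l : ℝ) : EReal) * score M γ μ₁ + ((l : ℝ) : EReal) * score M γ μ₂) ∧
    (∀ μ₁ μ₂ : (∀ i, X i) → ℝ, IsDist μ₁ → IsDist μ₂ →
      score M γ μ₁ < ⊤ → score M γ μ₂ < ⊤ →
      (∀ ν, IsDist ν → score M γ μ₁ ≤ score M γ ν) →
      (∀ ν, IsDist ν → score M γ μ₂ ≤ score M γ ν) → μ₁ = μ₂) := by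
  have main : ∀ (μ₁ μ₂ : (∀ i, X i) → ℝ) (l : ℝ), IsDist μ₁ → IsDist μ₂ →
      score M γ μ₁ < ⊤ → score M γ μ₂ < ⊤ → 0 ≤ l → l ≤ 1 →
      score M γ (fun w => (1 - l) * μ₁ w + l * μ₂ w) +
          (((γ / 2) * l * (1 - l) * (∑ w, |μ₁ w - μ₂ w|) ^ 2 : ℝ) : EReal) ≤
        ((1 - l : ℝ) : EReal) * score M γ μ₁ + ((l : ℝ) : EReal) * score M γ μ₂ := by
    intro μ₁ μ₂ l d1 d2 s1 s2 h0 h1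
    have a1 := admis_of_lt_top M γ hβ μ₁ s1
    have a2 := admis_of_lt_top M γ hβ μ₂ s2
    rw [score_eq M γ _ (isDist_mix μ₁ μ₂ l h0 h1 d1 d2).1 (admis_mix M μ₁ μ₂ l a1 a2),
      score_eq M γ μ₁ d1.1 a1, score_eq M γ μ₂ d2.1 a2, ← EReal.coe_add, ← EReal.coe_mul,
      ← EReal.coe_mul, ← EReal.coe_add]
    exact EReal.coe_le_coe_iff.2 (rscore_strong M γ hγ hβγ μ₁ μ₂ l h0 h1 d1 d2)
  refine ⟨main, ?_⟩
  intro μ₁ μ₂ d1 d2 s1 s2 m1 m2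
  have a1 := admis_of_lt_top M γ hβ μ₁ s1
  have a2 := admis_of_lt_top M γ hβ μ₂ s2
  have dm := isDist_mix μ₁ μ₂ (1 / 2) (by norm_num) (by norm_num) d1 d2
  have em := score_eq M γ _ dm.1 (admis_mix M μ₁ μ₂ (1 / 2) a1 a2)
  have key := rscore_strong M γ hγ hβγ μ₁ μ₂ (1 / 2) (by norm_num) (by norm_num) d1 d2
  have b1 := m1 _ dm
  have b2 := m2 _ dm
  rw [em, score_eq M γ μ₁ d1.1 a1, EReal.coe_le_coe_iff] at b1
  rw [em, score_eq M γ μ₂ d2.1 a2, EReal.coe_le_coe_iff] at b2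
  have hle : γ * (∑ w, |μ₁ w - μ₂ w|) ^ 2 ≤ 0 := by linarith
  have hsq : (∑ w, |μ₁ w - μ₂ w|) ^ 2 = 0 :=
    le_antisymm (nonpos_of_mul_nonpos_right hle hγ) (sq_nonneg _)
  have hs : ∑ w, |μ₁ w - μ₂ w| = 0 := pow_eq_zero_iff (two_ne_zero) |>.1 hsq
  funext w
  have := (Finset.sum_eq_zero_iff_of_nonneg fun w _ => abs_nonneg (μ₁ w - μ₂ w)).1 hs w
    (Finset.mem_univ w)
  exact sub_eq_zero.1 (abs_eq_zero.1 this)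

end Statement8
end

section
/- Let X and Y be nonempty finite types and let p assign to each x in X nonnegative reals p(y|x) with sum_y p(y|x) = 1. Let mu_0 and mu_1 be probability distributions on X × Y (nonnegative functions summing to 1), each satisfying mu_i(x,y) = 0 whenever p(y|x) = 0, and suppose they have different conditional marginals of Y given X: there exists (x,y) with mu_0(x,y)·mu_1(x) ≠ mu_1(x,y)·mu_0(x), where mu(x) := sum_y mu(x,y). For t in [0,1] define mu_t := (1−t)·mu_0 + t·mu_1 and F(t) := sum_{x,y} mu_t(x,y)·log( mu_t(x,y) / (mu_t(x)·p(y|x)) ), with the conventions 0·log 0 = 0 and 0·log(0/z) = 0. Then F is strictly convex on [0,1]: for all 0 <= t_1 < t_2 <= 1 and lambda in (0,1), F((1−lambda)·t_1 + lambda·t_2) < (1−lambda)·F(t_1) + lambda·F(t_2). -/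
open Finset

/-- The conditional relative entropy `∑_{x,y} μ(x,y)·log( μ(x,y)/(μ(x)·p(y|x)) )`, with the
conventions `0·log 0 = 0` and `0·log(0/z) = 0` built in via the guard. -/
noncomputable def condRelEnt {X Y : Type} [Fintype X] [Fintype Y]
    (p : X → Y → ℝ) (μ : X × Y → ℝ) : ℝ :=
  ∑ x, ∑ y, if μ (x, y) = 0 then 0 else
    μ (x, y) * Real.log (μ (x, y) / ((∑ y', μ (x, y')) * p x y))

theorem aux_strict (a b S T l : ℝ) (ha : 0 ≤ a) (hb : 0 ≤ b) (hS : 0 < S) (hT : 0 < T)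
    (hl : 0 < l) (hl1 : l < 1) (hne : a * T ≠ b * S) :
    ((1 - l) * a + l * b) * Real.log (((1 - l) * a + l * b) / ((1 - l) * S + l * T)) <
      (1 - l) * (a * Real.log (a / S)) + l * (b * Real.log (b / T)) := by
  have hm : 0 < 1 - l := by linarith
  have hU : 0 < (1 - l) * S + l * T := by positivity
  have hc := Real.strictConvexOn_mul_log
  unfold StrictConvexOn at hc
  have hc2 := hc.2
  have h := @hc2 (a / S)
    (Set.mem_Ici.2 (by positivity)) (b / T) (Set.mem_Ici.2 (by positivity))
    (by rw [Ne, div_eq_div_iff hS.ne' hT.ne']; exact hne)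
    ((1 - l) * S / ((1 - l) * S + l * T)) (l * T / ((1 - l) * S + l * T))
    (by positivity) (by positivity) (by field_simp)
  simp only [smul_eq_mul] at h
  have e : (1 - l) * S / ((1 - l) * S + l * T) * (a / S)
      + l * T / ((1 - l) * S + l * T) * (b / T)
      = ((1 - l) * a + l * b) / ((1 - l) * S + l * T) := by
    field_simp
  rw [e] at h
  have h2 := mul_lt_mul_of_pos_left h hU
  have e1 : ∀ L : ℝ, ((1 - l) * S + l * T) *
      (((1 - l) * a + l * b) / ((1 - l) * S + l * T) * L) = ((1 - l) * a + l * b) * L := by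
    intro L; field_simp
  have e2 : ∀ L M : ℝ, ((1 - l) * S + l * T) *
      ((1 - l) * S / ((1 - l) * S + l * T) * (a / S * L)
        + l * T / ((1 - l) * S + l * T) * (b / T * M))
      = (1 - l) * (a * L) + l * (b * M) := by
    intro L M; field_simp
  rwa [e1, e2] at h2

theorem aux_le (a b S T l : ℝ) (ha : 0 ≤ a) (hb : 0 ≤ b) (hS : 0 ≤ S) (hT : 0 ≤ T)
    (haS : S = 0 → a = 0) (hbT : T = 0 → b = 0)
    (hl : 0 < l) (hl1 : l < 1) :
    ((1 - l) * a + l * b) * Real.log (((1 - l) * a + l * b) / ((1 - l) * S + l * T)) ≤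
      (1 - l) * (a * Real.log (a / S)) + l * (b * Real.log (b / T)) := by
  have hm : 0 < 1 - l := by linarith
  rcases hS.eq_or_lt with h | hS
  · have h := h.symm
    have h' := haS h
    subst h h'
    simp only [mul_zero, zero_add, zero_mul, mul_div_mul_left _ _ hl.ne']
    linarith
  rcases hT.eq_or_lt with h | hT
  · have h := h.symm
    have h' := hbT h
    subst h h'
    simp only [mul_zero, add_zero, zero_mul, mul_div_mul_left _ _ hm.ne']
    linarith
  by_cases hne : a * T = b * S
  · have hb' : b = a * T / S := by field_simp; linarith
    have hU : 0 < (1 - l) * S + l * T := by positivity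
    have e1 : b / T = a / S := by rw [hb']; field_simp
    have e2 : ((1 - l) * a + l * b) / ((1 - l) * S + l * T) = a / S := by
      rw [div_eq_div_iff hU.ne' hS.ne']; linear_combination (-l) * hne
    rw [e1, e2]
    apply le_of_eq; ring
  · exact (aux_strict a b S T l ha hb hS hT hl hl1 hne).le

theorem aux_conv {X Y : Type} [Fintype X] [Fintype Y]
    (p : X → Y → ℝ) (hp0 : ∀ x y, 0 ≤ p x y) (m n k : X × Y → ℝ)
    (hm : ∀ z, 0 ≤ m z) (hn : ∀ z, 0 ≤ n z)
    (habm : ∀ x y, p x y = 0 → m (x, y) = 0)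
    (habn : ∀ x y, p x y = 0 → n (x, y) = 0) (l : ℝ) (hl : 0 < l) (hl1 : l < 1)
    (hk : ∀ z, k z = (1 - l) * m z + l * n z)
    (hdiff : ∃ x y, m (x, y) * (∑ y', n (x, y')) ≠ n (x, y) * (∑ y', m (x, y'))) :
    condRelEnt p k < (1 - l) * condRelEnt p m + l * condRelEnt p n := by
  have key : ∀ μ : X × Y → ℝ, condRelEnt p μ = ∑ z : X × Y,
      μ z * Real.log (μ z / ((∑ y', μ (z.1, y')) * p z.1 z.2)) := by
    intro μ
    rw [Fintype.sum_prod_type]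
    unfold condRelEnt
    refine sum_congr rfl fun x _ => sum_congr rfl fun y _ => ?_
    split_ifs with h
    · simp [h]
    · rfl
  have hz : ∀ μ : X × Y → ℝ, (∀ z, 0 ≤ μ z) → ∀ x y, (∑ y', μ (x, y')) = 0 → μ (x, y) = 0 := by
    intro μ h x y hs
    exact (sum_eq_zero_iff_of_nonneg (fun y' _ => h (x, y'))).1 hs y (mem_univ y)
  have hsum : ∀ x y, (∑ y', k (x, y')) * p x y =
      (1 - l) * ((∑ y', m (x, y')) * p x y) + l * ((∑ y', n (x, y')) * p x y) := by
    intro x y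
    simp only [hk, sum_add_distrib, ← mul_sum]
    ring
  have hSm : ∀ x, 0 ≤ ∑ y', m (x, y') := fun x => sum_nonneg fun y _ => hm _
  have hSn : ∀ x, 0 ≤ ∑ y', n (x, y') := fun x => sum_nonneg fun y _ => hn _
  rw [key, key, key, mul_sum, mul_sum, ← sum_add_distrib]
  apply sum_lt_sum
  · rintro ⟨x, y⟩ _
    simp only
    rw [hsum, hk]
    refine aux_le _ _ _ _ l (hm _) (hn _) (mul_nonneg (hSm x) (hp0 x y))
      (mul_nonneg (hSn x) (hp0 x y)) ?_ ?_ hl hl1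
    · intro h
      rcases mul_eq_zero.1 h with h | h
      · exact hz m hm x y h
      · exact habm x y h
    · intro h
      rcases mul_eq_zero.1 h with h | h
      · exact hz n hn x y h
      · exact habn x y h
  · obtain ⟨x, y, hxy⟩ := hdiff
    refine ⟨(x, y), mem_univ _, ?_⟩
    simp only
    rw [hsum, hk]
    have hp : 0 < p x y := by
      refine lt_of_le_of_ne (hp0 x y) fun h => hxy ?_
      rw [habm x y h.symm, habn x y h.symm]; simp
    have h1 : 0 < ∑ y', m (x, y') := by
      refine lt_of_le_of_ne (hSm x) fun h => hxy ?_
      rw [hz m hm x y h.symm, ← h]; simp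
    have h2 : 0 < ∑ y', n (x, y') := by
      refine lt_of_le_of_ne (hSn x) fun h => hxy ?_
      rw [hz n hn x y h.symm, ← h]; simp
    refine aux_strict _ _ _ _ l (hm _) (hn _) (mul_pos h1 hp) (mul_pos h2 hp) hl hl1 ?_
    intro h
    apply hxy
    apply mul_right_cancel₀ hp.ne'
    linarith

/-- If two distributions on `X × Y`, each absolutely continuous w.r.t. `p`, have different
conditional marginals of `Y` given `X`, then the conditional relative entropy is strictly
convex along the segment between them. -/
theorem stmt11 {X Y : Type} [Fintype X] [Fintype Y] [Nonempty X] [Nonempty Y]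
    (p : X → Y → ℝ) (hp0 : ∀ x y, 0 ≤ p x y) (hp1 : ∀ x, ∑ y, p x y = 1)
    (μ₀ μ₁ : X × Y → ℝ)
    (hμ₀ : (∀ z, 0 ≤ μ₀ z) ∧ ∑ z, μ₀ z = 1)
    (hμ₁ : (∀ z, 0 ≤ μ₁ z) ∧ ∑ z, μ₁ z = 1)
    (habs₀ : ∀ x y, p x y = 0 → μ₀ (x, y) = 0)
    (habs₁ : ∀ x y, p x y = 0 → μ₁ (x, y) = 0)
    (hdiff : ∃ x y, μ₀ (x, y) * (∑ y', μ₁ (x, y')) ≠ μ₁ (x, y) * (∑ y', μ₀ (x, y'))) :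
    ∀ t₁ t₂ l : ℝ, 0 ≤ t₁ → t₁ < t₂ → t₂ ≤ 1 → 0 < l → l < 1 →
      condRelEnt p (fun z => (1 - ((1 - l) * t₁ + l * t₂)) * μ₀ z +
          ((1 - l) * t₁ + l * t₂) * μ₁ z) <
        (1 - l) * condRelEnt p (fun z => (1 - t₁) * μ₀ z + t₁ * μ₁ z) +
          l * condRelEnt p (fun z => (1 - t₂) * μ₀ z + t₂ * μ₁ z) := by
  intro t₁ t₂ l h0 h12 h2 hl hl1
  have nn : ∀ t : ℝ, 0 ≤ t → t ≤ 1 → ∀ z, 0 ≤ (1 - t) * μ₀ z + t * μ₁ z := fun t h h' z =>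
    add_nonneg (mul_nonneg (by linarith) (hμ₀.1 z)) (mul_nonneg h (hμ₁.1 z))
  refine aux_conv p hp0 _ _ _ (nn t₁ h0 (by linarith)) (nn t₂ (by linarith) h2) ?_ ?_ l hl hl1 ?_ ?_
  · intro x y h
    simp [habs₀ x y h, habs₁ x y h]
  · intro x y h
    simp [habs₀ x y h, habs₁ x y h]
  · intro z
    ring
  · obtain ⟨x, y, hxy⟩ := hdiff
    refine ⟨x, y, fun h => hxy ?_⟩
    simp only [sum_add_distrib, ← mul_sum] at h
    have ht : t₂ - t₁ ≠ 0 := (sub_pos.2 h12).ne'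
    apply mul_left_cancel₀ ht
    linear_combination h
end

section
/- Suppose E is nonempty and E ≠ Omega. Let F : Delta → ℝ be convex and be the restriction of a continuously differentiable function defined on an open neighborhood of Delta in ℝ^Omega. Suppose that for every p in (0,1) the function mu ↦ F(mu) + kl(mu(E)‖p) has a unique minimizer mu*_p over Delta, that mu*_p has all coordinates strictly positive, and that the map p ↦ mu*_p is differentiable on (0,1). Then the value function f is differentiable on (0,1) and f'(p) = (p − mu*_p(E)) / (p·(1−p)) for every p in (0,1). -/
open Finset

section SimplexSetup

variable {Ω : Type} [Fintype Ω] [Nonempty Ω] [DecidableEq Ω]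

/-- The probability simplex on a finite type `Ω`, as a subset of `ℝ^Ω`. -/
def Delta (Ω : Type) [Fintype Ω] : Set (Ω → ℝ) := {μ | (∀ ω, 0 ≤ μ ω) ∧ ∑ ω, μ ω = 1}

/-- The probability `μ(E) = ∑_{ω ∈ E} μ(ω)` of an event `E`. -/
def margE (E : Finset Ω) (μ : Ω → ℝ) : ℝ := ∑ ω ∈ E, μ ω

/-- The ℓ1 norm `‖v‖₁ = ∑ |v ω|` on `ℝ^Ω`. -/
def l1 (v : Ω → ℝ) : ℝ := ∑ ω, |v ω|

/-- The binary relative entropy `kl(q‖p)` for `q ∈ [0,1]` and `p ∈ (0,1)` (the convention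
`0·log 0 = 0` is automatic since `Real.log 0 = 0`). -/
noncomputable def klb (q p : ℝ) : ℝ :=
  q * Real.log (q / p) + (1 - q) * Real.log ((1 - q) / (1 - p))

/-- The value function `f(p) = inf_{μ ∈ Δ} [ F(μ) + kl(μ(E)‖p) ]`. -/
noncomputable def valf (E : Finset Ω) (F : (Ω → ℝ) → ℝ) (p : ℝ) : ℝ :=
  sInf ((fun μ => F μ + klb (margE E μ) p) '' Delta Ω)

/-- `F` is `γ`-strongly convex on the simplex with respect to the ℓ1 norm. -/
def StrongConvexL1 (γ : ℝ) (F : (Ω → ℝ) → ℝ) : Prop :=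
  ∀ μ₁ ∈ Delta Ω, ∀ μ₂ ∈ Delta Ω, ∀ l : ℝ, 0 ≤ l → l ≤ 1 →
    F (fun ω => (1 - l) * μ₁ ω + l * μ₂ ω) ≤
      (1 - l) * F μ₁ + l * F μ₂ - (γ / 2) * l * (1 - l) * (l1 (fun ω => μ₁ ω - μ₂ ω)) ^ 2

end SimplexSetup

section Statement13

variable {Ω : Type} [Fintype Ω] [Nonempty Ω] [DecidableEq Ω]

/-- If for each `p ∈ (0,1)` the problem `min_{μ ∈ Δ} F(μ) + kl(μ(E)‖p)` has a unique,
everywhere-positive minimizer `μ*_p` depending differentiably on `p`, then the value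
function `f` is differentiable on `(0,1)` with `f'(p) = (p − μ*_p(E)) / (p(1−p))`. -/
theorem stmt13 (E : Finset Ω) (hE : E.Nonempty) (hEuniv : E ≠ univ)
    (F : (Ω → ℝ) → ℝ) (hconv : ConvexOn ℝ (Delta Ω) F)
    (hsmooth : ∃ U : Set (Ω → ℝ), IsOpen U ∧ Delta Ω ⊆ U ∧ ContDiffOn ℝ 1 F U)
    (mustar : ℝ → (Ω → ℝ))
    (hmem : ∀ p ∈ Set.Ioo (0 : ℝ) 1, mustar p ∈ Delta Ω)
    (hmin : ∀ p ∈ Set.Ioo (0 : ℝ) 1, ∀ μ ∈ Delta Ω,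
      F (mustar p) + klb (margE E (mustar p)) p ≤ F μ + klb (margE E μ) p)
    (huniq : ∀ p ∈ Set.Ioo (0 : ℝ) 1, ∀ μ ∈ Delta Ω,
      (∀ ν ∈ Delta Ω, F μ + klb (margE E μ) p ≤ F ν + klb (margE E ν) p) → μ = mustar p)
    (hpos : ∀ p ∈ Set.Ioo (0 : ℝ) 1, ∀ ω, 0 < mustar p ω)
    (hdiff : DifferentiableOn ℝ mustar (Set.Ioo (0 : ℝ) 1)) :
    ∀ p ∈ Set.Ioo (0 : ℝ) 1,
      HasDerivAt (valf E F) ((p - margE E (mustar p)) / (p * (1 - p))) p := by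
  intro p hp
  obtain ⟨U, hUo, hUs, hUF⟩ := hsmooth
  have hp0 : 0 < p := hp.1
  have hp1 : 0 < 1 - p := by linarith [hp.2]
  have hval : ∀ s ∈ Set.Ioo (0 : ℝ) 1,
      valf E F s = F (mustar s) + klb (margE E (mustar s)) s := by
    intro s hs
    apply IsLeast.csInf_eq
    refine ⟨⟨mustar s, hmem s hs, rfl⟩, ?_⟩
    rintro _ ⟨μ, hμ, rfl⟩
    exact hmin s hs μ hμ
  have hnhds : Set.Ioo (0 : ℝ) 1 ∈ nhds p := isOpen_Ioo.mem_nhds hp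
  have hq0 : 0 < margE E (mustar p) := Finset.sum_pos (fun ω _ => hpos p hp ω) hE
  have hq1 : 0 < 1 - margE E (mustar p) := by
    have h1 := (hmem p hp).2
    obtain ⟨ω, hω⟩ : ∃ ω, ω ∉ E := by
      by_contra hcon
      push Not at hcon
      exact hEuniv (Finset.eq_univ_iff_forall.2 hcon)
    have h2 : margE E (mustar p) < ∑ ω, mustar p ω :=
      Finset.sum_lt_sum_of_subset (Finset.subset_univ E) (Finset.mem_univ ω) hω
        (hpos p hp ω) (fun j _ _ => (hpos p hp j).le)
    linarith
  have hmd : DifferentiableAt ℝ mustar p := hdiff.differentiableAt hnhds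
  have hqd : DifferentiableAt ℝ (fun s => margE E (mustar s)) p := by
    unfold margE
    exact DifferentiableAt.fun_sum (fun ω _ => (differentiableAt_pi.1 hmd) ω)
  have hFd : DifferentiableAt ℝ F (mustar p) :=
    (hUF.differentiableOn (by norm_num)).differentiableAt (hUo.mem_nhds (hUs (hmem p hp)))
  have hFm : DifferentiableAt ℝ (fun s => F (mustar s)) p := hFd.comp p hmd
  have hkd : DifferentiableAt ℝ (fun s => klb (margE E (mustar s)) s) p := by
    unfold klb
    have hid : DifferentiableAt ℝ (fun s : ℝ => s) p := differentiableAt_id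
    have a1 : DifferentiableAt ℝ (fun s => 1 - margE E (mustar s)) p := hqd.const_sub 1
    have a2 : DifferentiableAt ℝ (fun s : ℝ => 1 - s) p := hid.const_sub 1
    exact (hqd.mul ((hqd.div hid hp0.ne').log (div_pos hq0 hp0).ne')).add
      (a1.mul ((a1.div a2 hp1.ne').log (div_pos hq1 hp1).ne'))
  have hvd : DifferentiableAt ℝ (valf E F) p := by
    refine (hFm.add hkd).congr_of_eventuallyEq ?_
    filter_upwards [hnhds] with s hs
    exact hval s hs
  set q := margE E (mustar p) with hq
  have hg : HasDerivAt (fun s => F (mustar p) + klb q s) ((p - q) / (p * (1 - p))) p := by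
    have h1 : HasDerivAt (fun s : ℝ => q / s) (-q / p ^ 2) p := by
      have := (hasDerivAt_const p q).div (hasDerivAt_id p) hp0.ne'
      exact this.congr_deriv (by simp)
    have h2 : HasDerivAt (fun s : ℝ => (1 - q) / (1 - s)) ((1 - q) / (1 - p) ^ 2) p := by
      have := (hasDerivAt_const p (1 - q)).div ((hasDerivAt_id p).const_sub 1) hp1.ne'
      exact this.congr_deriv (by simp)
    have h3 := (((h1.log (div_pos hq0 hp0).ne').const_mul q).add
      ((h2.log (div_pos hq1 hp1).ne').const_mul (1 - q))).const_add (F (mustar p))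
    refine h3.congr_deriv ?_
    have := hq0.ne'
    have := hq1.ne'
    have := hp0.ne'
    have := hp1.ne'
    field_simp
    ring
  have hmn : IsLocalMin (fun s => (F (mustar p) + klb q s) - valf E F s) p := by
    filter_upwards [hnhds] with s hs
    have h1 := hmin s hs (mustar p) (hmem p hp)
    rw [hval p hp, hval s hs]
    linarith
  have h0 := hmn.hasDerivAt_eq_zero (hg.sub hvd.hasDerivAt)
  have h4 : deriv (valf E F) p = (p - q) / (p * (1 - p)) := by linarith
  rw [← h4]
  exact hvd.hasDerivAt

end Statement13
end

section
/- Let gamma > 0 and suppose F : Delta → ℝ is gamma-strongly convex with respect to the ℓ1 norm. Let 0 < p_1 < p_2 < 1, let mu_1* minimize mu ↦ F(mu) + kl(mu(E)‖p_1) over Delta and mu_2* minimize mu ↦ F(mu) + kl(mu(E)‖p_2) over Delta, and suppose the value function f is differentiable at p_1. Then f(p_2) >= f(p_1) + f'(p_1)·(p_2 − p_1) + (gamma/2)·‖mu_1* − mu_2*‖₁². -/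
open Finset

section Statement14

variable {Ω : Type} [Fintype Ω] [Nonempty Ω] [DecidableEq Ω]

lemma klaux_tangent {a b c : ℝ} (ha : 0 ≤ a) (hb : 0 < b) (hc : 0 < c) :
    a * Real.log c + a - b * c ≤ a * Real.log (a / b) := by
  rcases ha.eq_or_lt with rfl | ha
  · have := mul_pos hb hc
    simp; linarith
  · have h := Real.one_sub_inv_le_log_of_pos (x := a / (b * c)) (by positivity)
    have e : Real.log (a / (b * c)) = Real.log (a / b) - Real.log c := by
      rw [← div_div, Real.log_div (by positivity) (by positivity)]
    rw [e] at h
    have h2 := mul_le_mul_of_nonneg_left h ha.le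
    have e2 : a * (1 - (a / (b * c))⁻¹) = a - b * c := by field_simp
    rw [e2] at h2
    linarith

lemma klaux_logsum {a₁ a₂ b₁ b₂ l : ℝ} (ha₁ : 0 ≤ a₁) (ha₂ : 0 ≤ a₂) (hb₁ : 0 < b₁)
    (hb₂ : 0 < b₂) (hl : 0 ≤ l) (hl1 : l ≤ 1) :
    ((1 - l) * a₁ + l * a₂) *
        Real.log (((1 - l) * a₁ + l * a₂) / ((1 - l) * b₁ + l * b₂)) ≤
      (1 - l) * (a₁ * Real.log (a₁ / b₁)) + l * (a₂ * Real.log (a₂ / b₂)) := by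
  have hl' : 0 ≤ 1 - l := by linarith
  have hB : 0 < (1 - l) * b₁ + l * b₂ := by
    rcases hl.eq_or_lt with rfl | h
    · simpa using hb₁
    · have := mul_pos h hb₂
      have := mul_nonneg hl' hb₁.le
      linarith
  have hA : 0 ≤ (1 - l) * a₁ + l * a₂ := by positivity
  set A := (1 - l) * a₁ + l * a₂ with hAd
  set B := (1 - l) * b₁ + l * b₂ with hBd
  rcases hA.eq_or_lt with h0 | hA
  · have h1 : (1 - l) * a₁ = 0 := by
      have := mul_nonneg hl' ha₁
      have := mul_nonneg hl ha₂
      linarith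
    have h2 : l * a₂ = 0 := by linarith
    rw [← h0, ← mul_assoc, ← mul_assoc, h1, h2]; simp
  · have hc : 0 < A / B := by positivity
    have t1 := mul_le_mul_of_nonneg_left (klaux_tangent ha₁ hb₁ hc) hl'
    have t2 := mul_le_mul_of_nonneg_left (klaux_tangent ha₂ hb₂ hc) hl
    have e : B * (A / B) = A := by field_simp
    have e3 : (1 - l) * (a₁ * Real.log (A / B) + a₁ - b₁ * (A / B)) +
        l * (a₂ * Real.log (A / B) + a₂ - b₂ * (A / B)) =
        A * Real.log (A / B) + A - B * (A / B) := by
      rw [hAd, hBd]; ring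
    linarith

lemma klaux_klb_convex {q₁ q₂ p₁ p₂ l : ℝ} (h₁ : 0 ≤ q₁) (h₁' : q₁ ≤ 1) (h₂ : 0 ≤ q₂)
    (h₂' : q₂ ≤ 1) (hp₁ : 0 < p₁) (hp₁' : p₁ < 1) (hp₂ : 0 < p₂) (hp₂' : p₂ < 1)
    (hl : 0 ≤ l) (hl1 : l ≤ 1) :
    klb ((1 - l) * q₁ + l * q₂) ((1 - l) * p₁ + l * p₂) ≤
      (1 - l) * klb q₁ p₁ + l * klb q₂ p₂ := by
  have a := klaux_logsum h₁ h₂ hp₁ hp₂ hl hl1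
  have b := klaux_logsum (sub_nonneg.2 h₁') (sub_nonneg.2 h₂') (sub_pos.2 hp₁')
    (sub_pos.2 hp₂') hl hl1
  have e : ∀ x y : ℝ, (1 - l) * (1 - x) + l * (1 - y) = 1 - ((1 - l) * x + l * y) := by
    intro x y; ring
  rw [e, e] at b
  unfold klb
  linarith

lemma klaux_klb_nonneg {q p : ℝ} (h : 0 ≤ q) (h' : q ≤ 1) (hp : 0 < p) (hp' : p < 1) :
    0 ≤ klb q p := by
  have a := klaux_tangent h hp one_pos
  have b := klaux_tangent (sub_nonneg.2 h') (sub_pos.2 hp') one_pos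
  simp only [Real.log_one] at a b
  unfold klb
  linarith

lemma klaux_bound {q p : ℝ} (h : 0 ≤ q) (h' : q ≤ 1) (hp : 0 < p) (hp' : p < 1) :
    q * Real.log (q / p) ≤ - Real.log p := by
  have hlp : Real.log p ≤ 0 := Real.log_nonpos hp.le hp'.le
  rcases h.eq_or_lt with rfl | h
  · simpa using hlp
  · rw [Real.log_div h.ne' hp.ne']
    have : Real.log q ≤ 0 := Real.log_nonpos h.le h'
    nlinarith [mul_nonneg h.le (neg_nonneg.2 this), mul_nonneg (sub_nonneg.2 h') (neg_nonneg.2 hlp)]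

lemma klaux_klb_le {q p : ℝ} (h : 0 ≤ q) (h' : q ≤ 1) (hp : 0 < p) (hp' : p < 1) :
    klb q p ≤ - Real.log p - Real.log (1 - p) := by
  have a := klaux_bound h h' hp hp'
  have b := klaux_bound (q := 1 - q) (p := 1 - p) (by linarith) (by linarith) (by linarith)
    (by linarith)
  unfold klb
  linarith

lemma klaux_marg_mem (E : Finset Ω) {μ : Ω → ℝ} (h : μ ∈ Delta Ω) :
    0 ≤ margE E μ ∧ margE E μ ≤ 1 := by
  refine ⟨Finset.sum_nonneg fun ω _ => h.1 ω, ?_⟩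
  rw [← h.2]
  exact Finset.sum_le_sum_of_subset_of_nonneg (Finset.subset_univ E) fun ω _ _ => h.1 ω

lemma klaux_mix_mem {μ ν : Ω → ℝ} (h : μ ∈ Delta Ω) (h' : ν ∈ Delta Ω) {l : ℝ}
    (hl : 0 ≤ l) (hl1 : l ≤ 1) : (fun ω => (1 - l) * μ ω + l * ν ω) ∈ Delta Ω := by
  refine ⟨fun ω => ?_, ?_⟩
  · have := mul_nonneg (sub_nonneg.2 hl1) (h.1 ω)
    have := mul_nonneg hl (h'.1 ω)
    linarith
  · rw [Finset.sum_add_distrib, ← Finset.mul_sum, ← Finset.mul_sum, h.2, h'.2]; ring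

lemma klaux_marg_mix (E : Finset Ω) (μ ν : Ω → ℝ) (l : ℝ) :
    margE E (fun ω => (1 - l) * μ ω + l * ν ω) = (1 - l) * margE E μ + l * margE E ν := by
  unfold margE
  rw [Finset.sum_add_distrib, ← Finset.mul_sum, ← Finset.mul_sum]

/-- If `F` is `γ`-strongly convex w.r.t. the ℓ1 norm, then the value function satisfies
`f(p₂) ≥ f(p₁) + f'(p₁)(p₂ − p₁) + (γ/2)‖μ₁* − μ₂*‖₁²` for minimizers `μ₁*, μ₂*` at
`p₁ < p₂`. -/
theorem stmt14 (E : Finset Ω) (γ : ℝ) (hγ : 0 < γ)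
    (F : (Ω → ℝ) → ℝ) (hsc : StrongConvexL1 γ F)
    (p₁ p₂ : ℝ) (hp₁ : 0 < p₁) (hp₁₂ : p₁ < p₂) (hp₂ : p₂ < 1)
    (μ₁s μ₂s : Ω → ℝ) (hμ₁mem : μ₁s ∈ Delta Ω) (hμ₂mem : μ₂s ∈ Delta Ω)
    (hμ₁min : ∀ μ ∈ Delta Ω, F μ₁s + klb (margE E μ₁s) p₁ ≤ F μ + klb (margE E μ) p₁)
    (hμ₂min : ∀ μ ∈ Delta Ω, F μ₂s + klb (margE E μ₂s) p₂ ≤ F μ + klb (margE E μ) p₂)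
    (d : ℝ) (hd : HasDerivAt (valf E F) d p₁) :
    valf E F p₁ + d * (p₂ - p₁) + (γ / 2) * (l1 (fun ω => μ₁s ω - μ₂s ω)) ^ 2 ≤
      valf E F p₂ := by
  have hp₁' : p₁ < 1 := hp₁₂.trans hp₂
  have hp₂' : 0 < p₂ := hp₁.trans hp₁₂
  have hbdd : ∀ p, 0 < p → p < 1 →
      BddBelow ((fun μ => F μ + klb (margE E μ) p) '' Delta Ω) := by
    intro p hp hp'
    refine ⟨F μ₁s + klb (margE E μ₁s) p₁ + Real.log p₁ + Real.log (1 - p₁), ?_⟩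
    rintro _ ⟨μ, hμ, rfl⟩
    obtain ⟨h0, h1⟩ := klaux_marg_mem E hμ
    have := hμ₁min μ hμ
    have := klaux_klb_le h0 h1 hp₁ hp₁'
    have := klaux_klb_nonneg h0 h1 hp hp'
    show _ ≤ F μ + klb (margE E μ) p
    linarith
  have hval : ∀ p, 0 < p → p < 1 → ∀ μ ∈ Delta Ω, valf E F p ≤ F μ + klb (margE E μ) p :=
    fun p hp hp' μ hμ => csInf_le (hbdd p hp hp') ⟨μ, hμ, rfl⟩
  have heq₁ : valf E F p₁ = F μ₁s + klb (margE E μ₁s) p₁ := by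
    refine le_antisymm (hval p₁ hp₁ hp₁' _ hμ₁mem) (le_csInf ⟨_, μ₁s, hμ₁mem, rfl⟩ ?_)
    rintro _ ⟨μ, hμ, rfl⟩
    exact hμ₁min μ hμ
  have heq₂ : valf E F p₂ = F μ₂s + klb (margE E μ₂s) p₂ := by
    refine le_antisymm (hval p₂ hp₂' hp₂ _ hμ₂mem) (le_csInf ⟨_, μ₂s, hμ₂mem, rfl⟩ ?_)
    rintro _ ⟨μ, hμ, rfl⟩
    exact hμ₂min μ hμ
  set N := (l1 (fun ω => μ₁s ω - μ₂s ω)) ^ 2 with hN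
  have key : ∀ l : ℝ, 0 ≤ l → l ≤ 1 → valf E F (p₁ + l * (p₂ - p₁)) ≤
      (1 - l) * valf E F p₁ + l * valf E F p₂ - (γ / 2) * l * (1 - l) * N := by
    intro l hl hl1
    have e : p₁ + l * (p₂ - p₁) = (1 - l) * p₁ + l * p₂ := by ring
    have q1 : 0 < p₁ + l * (p₂ - p₁) := by nlinarith
    have q2 : p₁ + l * (p₂ - p₁) < 1 := by nlinarith
    have h1 := hval _ q1 q2 _ (klaux_mix_mem hμ₁mem hμ₂mem hl hl1)
    have h2 := hsc _ hμ₁mem _ hμ₂mem l hl hl1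
    obtain ⟨a0, a1⟩ := klaux_marg_mem E hμ₁mem
    obtain ⟨b0, b1⟩ := klaux_marg_mem E hμ₂mem
    have h3 := klaux_klb_convex a0 a1 b0 b1 hp₁ hp₁' hp₂' hp₂ hl hl1
    rw [klaux_marg_mix] at h1
    rw [← e] at h3
    rw [heq₁, heq₂]
    linarith
  have hg : HasDerivAt (fun l : ℝ => valf E F (p₁ + l * (p₂ - p₁))) (d * (p₂ - p₁)) 0 := by
    have hi : HasDerivAt (fun l : ℝ => p₁ + l * (p₂ - p₁)) (p₂ - p₁) 0 := by
      simpa using ((hasDerivAt_id (0 : ℝ)).mul_const (p₂ - p₁)).const_add p₁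
    have hd' : HasDerivAt (valf E F) d (p₁ + 0 * (p₂ - p₁)) := by simpa using hd
    have hc := HasDerivAt.comp (h₂ := valf E F) (h := fun l : ℝ => p₁ + l * (p₂ - p₁)) (0 : ℝ) hd' hi
    exact hc
  have hs := hg.tendsto_slope_zero_right
  have ht : Filter.Tendsto (fun l : ℝ => valf E F p₂ - valf E F p₁ - (γ / 2) * (1 - l) * N)
      (nhdsWithin 0 (Set.Ioi 0)) (nhds (valf E F p₂ - valf E F p₁ - (γ / 2) * (1 - 0) * N)) := by
    apply Filter.Tendsto.mono_left _ nhdsWithin_le_nhds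
    apply Continuous.tendsto
    fun_prop
  have hle := le_of_tendsto_of_tendsto hs ht (by
    filter_upwards [Ioo_mem_nhdsGT (show (0 : ℝ) < 1 from one_pos)] with l hl
    have h := key l hl.1.le hl.2.le
    simp only [zero_add, zero_mul, add_zero, smul_eq_mul]
    rw [inv_mul_le_iff₀ hl.1]
    linarith)
  linarith

end Statement14
end

section
/- Let F : Delta → ℝ be convex and be the restriction of a differentiable function on an open neighborhood of Delta in ℝ^Omega. Let p_1, p_2 in (0,1), let mu_1* minimize mu ↦ F(mu) + kl(mu(E)‖p_1) over Delta and mu_2* minimize mu ↦ F(mu) + kl(mu(E)‖p_2) over Delta, and set m_1 := mu_1*(E) and m_2 := mu_2*(E). Suppose mu_2* has all coordinates strictly positive and m_2 in (0,1). Then F(mu_1*) − F(mu_2*) >= (m_2 − m_1)·log( (m_2·(1−p_2)) / (p_2·(1−m_2)) ). -/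
open Finset

section Statement15

variable {Ω : Type} [Fintype Ω] [Nonempty Ω] [DecidableEq Ω]

theorem klb_hasDerivAt (m p : ℝ) (hm : m ∈ Set.Ioo (0 : ℝ) 1) (hp : p ∈ Set.Ioo (0 : ℝ) 1) :
    HasDerivAt (fun q => klb q p) (Real.log ((m * (1 - p)) / (p * (1 - m)))) m := by
  obtain ⟨hm0, hm1⟩ := hm
  obtain ⟨hp0, hp1⟩ := hp
  have hm1' : 0 < 1 - m := by linarith
  have hp1' : 0 < 1 - p := by linarith
  have h1 : HasDerivAt (fun q : ℝ => q / p) (1 / p) m := (hasDerivAt_id m).div_const p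
  have h2 : HasDerivAt (fun q : ℝ => 1 - q) (-1) m := by
    simpa using (hasDerivAt_id m).const_sub 1
  have h3 : HasDerivAt (fun q : ℝ => (1 - q) / (1 - p)) (-1 / (1 - p)) m := h2.div_const _
  have h4 := (hasDerivAt_id m).mul (h1.log (div_pos hm0 hp0).ne')
  have h5 := h2.mul (h3.log (div_pos hm1' hp1').ne')
  have h6 := h4.add h5
  unfold klb
  refine h6.congr_deriv ?_
  have e : Real.log ((m * (1 - p)) / (p * (1 - m)))
      = Real.log (m / p) - Real.log ((1 - m) / (1 - p)) := by
    rw [← Real.log_div (div_pos hm0 hp0).ne' (div_pos hm1' hp1').ne']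
    congr 1
    field_simp
  rw [e]
  simp only [id]
  field_simp
  ring

/-- A gradient bound: for minimizers `μ₁*, μ₂*` at parameters `p₁, p₂ ∈ (0,1)` with `μ₂*`
strictly positive and `m₂ = μ₂*(E) ∈ (0,1)`,
`F(μ₁*) − F(μ₂*) ≥ (m₂ − m₁)·log( m₂(1−p₂) / (p₂(1−m₂)) )`. -/
theorem stmt15 (E : Finset Ω)
    (F : (Ω → ℝ) → ℝ) (hconv : ConvexOn ℝ (Delta Ω) F)
    (hsmooth : ∃ U : Set (Ω → ℝ), IsOpen U ∧ Delta Ω ⊆ U ∧ DifferentiableOn ℝ F U)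
    (p₁ p₂ : ℝ) (hp₁ : p₁ ∈ Set.Ioo (0 : ℝ) 1) (hp₂ : p₂ ∈ Set.Ioo (0 : ℝ) 1)
    (μ₁s μ₂s : Ω → ℝ) (hμ₁mem : μ₁s ∈ Delta Ω) (hμ₂mem : μ₂s ∈ Delta Ω)
    (hμ₁min : ∀ μ ∈ Delta Ω, F μ₁s + klb (margE E μ₁s) p₁ ≤ F μ + klb (margE E μ) p₁)
    (hμ₂min : ∀ μ ∈ Delta Ω, F μ₂s + klb (margE E μ₂s) p₂ ≤ F μ + klb (margE E μ) p₂)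
    (hμ₂pos : ∀ ω, 0 < μ₂s ω) (hm₂ : margE E μ₂s ∈ Set.Ioo (0 : ℝ) 1) :
    (margE E μ₂s - margE E μ₁s) *
        Real.log ((margE E μ₂s * (1 - p₂)) / (p₂ * (1 - margE E μ₂s))) ≤
      F μ₁s - F μ₂s := by
  have hk := klb_hasDerivAt _ p₂ hm₂ hp₂
  set m₂ := margE E μ₂s with hm₂def
  set m₁ := margE E μ₁s with hm₁def
  set L := Real.log ((m₂ * (1 - p₂)) / (p₂ * (1 - m₂))) with hL
  have hline : HasDerivAt (fun t : ℝ => m₂ + t * (m₁ - m₂)) (m₁ - m₂) 0 := by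
    simpa using ((hasDerivAt_id (0 : ℝ)).mul_const (m₁ - m₂)).const_add m₂
  have hk' : HasDerivAt (fun q => klb q p₂) L (m₂ + 0 * (m₁ - m₂)) := by simpa using hk
  have hc : HasDerivAt (fun t : ℝ => klb (m₂ + t * (m₁ - m₂)) p₂) (L * (m₁ - m₂)) 0 :=
    HasDerivAt.comp (h₂ := fun q => klb q p₂) (0 : ℝ) hk' hline
  have ht := hc.tendsto_slope_zero_right
  have key : -(F μ₁s - F μ₂s) ≤ L * (m₁ - m₂) := by
    refine ge_of_tendsto ht ?_
    filter_upwards [Ioo_mem_nhdsGT (show (0 : ℝ) < 1 by norm_num)] with t htt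
    obtain ⟨ht0, ht1⟩ := htt
    have hmem := hconv.1 hμ₂mem hμ₁mem (by linarith : 0 ≤ 1 - t) ht0.le (by ring)
    have hF := hconv.2 hμ₂mem hμ₁mem (by linarith : 0 ≤ 1 - t) ht0.le (by ring)
    have hmin := hμ₂min _ hmem
    have hmarg : margE E ((1 - t) • μ₂s + t • μ₁s) = m₂ + t * (m₁ - m₂) := by
      have : margE E ((1 - t) • μ₂s + t • μ₁s) = (1 - t) * m₂ + t * m₁ := by
        simp only [hm₂def, hm₁def, margE, Pi.add_apply, Pi.smul_apply, smul_eq_mul,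
          Finset.sum_add_distrib, Finset.mul_sum]
      rw [this]; ring
    rw [hmarg] at hmin
    simp only [smul_eq_mul] at hF ⊢
    simp only [zero_add, zero_mul, add_zero]
    rw [inv_mul_eq_div, le_div_iff₀ ht0]
    nlinarith
  linarith

end Statement15
end

section
/- Let F : Delta → ℝ be convex and be the restriction of a differentiable function on an open neighborhood of Delta in ℝ^Omega, and suppose E is nonempty with E ≠ Omega. Let 0 < b < z < 1, let mu_b* minimize mu ↦ F(mu) + kl(mu(E)‖b) over Delta and mu_z* minimize mu ↦ F(mu) + kl(mu(E)‖z) over Delta, with mu_z* having all coordinates strictly positive. Set m_b := mu_b*(E) and m_z := mu_z*(E), and assume m_b >= b, z <= m_z < 1, and ‖mu_b* − mu_z*‖₁ <= delta. Then f(b) − f(z) >= 2·(z − b)² − (delta/2)·log( (z·(1−b)) / (b·(1−z)) ). -/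
open Finset

theorem pinsker_aux (b z : ℝ) (hb : 0 < b) (hbz : b < z) (hz : z < 1) :
    2 * (z - b) ^ 2 ≤ z * (Real.log z - Real.log b)
      + (1 - z) * (Real.log (1 - z) - Real.log (1 - b)) := by
  have hd : ∀ x ∈ Set.Icc b z, HasDerivAt
      (fun x : ℝ => -z * Real.log x - (1 - z) * Real.log (1 - x) - 2 * (z - x) ^ 2)
      (-z * x⁻¹ - (1 - z) * (-1 / (1 - x)) - 2 * (2 * (z - x) * (-1))) x := by
    intro x hx
    have h0 : x ≠ 0 := by have := hx.1; intro h; linarith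
    have h1 : 1 - x ≠ 0 := by have := hx.2; intro h; linarith
    have e1 := (Real.hasDerivAt_log h0).const_mul (-z)
    have e2 := (((hasDerivAt_id x).const_sub 1).log h1).const_mul (1 - z)
    have e3 := ((((hasDerivAt_id x).const_sub z).pow 2)).const_mul 2
    have e := (e1.sub e2).sub e3
    exact e.congr_deriv (by simp)
  have hanti : AntitoneOn
      (fun x : ℝ => -z * Real.log x - (1 - z) * Real.log (1 - x) - 2 * (z - x) ^ 2)
      (Set.Icc b z) := by
    apply antitoneOn_of_deriv_nonpos (convex_Icc b z)
    · exact fun x hx => (hd x hx).continuousAt.continuousWithinAt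
    · exact fun x hx => (hd x (interior_subset hx)).differentiableAt.differentiableWithinAt
    · intro x hx
      have hx' := interior_subset hx
      rw [(hd x hx').deriv]
      have h0 : 0 < x := lt_of_lt_of_le hb hx'.1
      have h1 : 0 < 1 - x := by linarith [hx'.2]
      have key : -z * x⁻¹ - (1 - z) * (-1 / (1 - x)) - 2 * (2 * (z - x) * (-1))
          = -((z - x) * (1 - 2 * x) ^ 2 / (x * (1 - x))) := by
        field_simp
        ring
      rw [key]
      have h2 : 0 ≤ z - x := by linarith [hx'.2]
      have : 0 ≤ (z - x) * (1 - 2 * x) ^ 2 / (x * (1 - x)) := by positivity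
      linarith
  have := hanti (Set.left_mem_Icc.2 hbz.le) (Set.right_mem_Icc.2 hbz.le) hbz.le
  simp only [sub_self] at this
  nlinarith [this]

theorem klb_diff_aux (q b z : ℝ) (hq0 : 0 ≤ q) (hq1 : q ≤ 1) (hb : 0 < b) (hb1 : b < 1)
    (hz0 : 0 < z) (hz : z < 1) :
    klb q b - klb q z = q * (Real.log z - Real.log b)
      + (1 - q) * (Real.log (1 - z) - Real.log (1 - b)) := by
  have A : ∀ t c : ℝ, 0 < c → t * Real.log (t / c) = t * (Real.log t - Real.log c) := by
    intro t c hc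
    rcases eq_or_ne t 0 with h | h
    · simp [h]
    · rw [Real.log_div h hc.ne']
  unfold klb
  rw [A q b hb, A q z hz0, A _ _ (sub_pos.2 hb1), A _ _ (sub_pos.2 hz)]
  ring

section Statement16

variable {Ω : Type} [Fintype Ω] [Nonempty Ω] [DecidableEq Ω]

/-- If the minimizers at `b < z` are at ℓ1 distance at most `δ`, then
`f(b) − f(z) ≥ 2(z−b)² − (δ/2)·log( z(1−b) / (b(1−z)) )`. -/
theorem stmt16 (E : Finset Ω) (hE : E.Nonempty) (hEuniv : E ≠ univ)
    (F : (Ω → ℝ) → ℝ) (hconv : ConvexOn ℝ (Delta Ω) F)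
    (hsmooth : ∃ U : Set (Ω → ℝ), IsOpen U ∧ Delta Ω ⊆ U ∧ DifferentiableOn ℝ F U)
    (b z : ℝ) (hb : 0 < b) (hbz : b < z) (hz : z < 1)
    (μbs μzs : Ω → ℝ) (hμbmem : μbs ∈ Delta Ω) (hμzmem : μzs ∈ Delta Ω)
    (hμbmin : ∀ μ ∈ Delta Ω, F μbs + klb (margE E μbs) b ≤ F μ + klb (margE E μ) b)
    (hμzmin : ∀ μ ∈ Delta Ω, F μzs + klb (margE E μzs) z ≤ F μ + klb (margE E μ) z)
    (hμzpos : ∀ ω, 0 < μzs ω)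
    (hmb : b ≤ margE E μbs) (hmz : z ≤ margE E μzs) (hmz1 : margE E μzs < 1)
    (δ : ℝ) (hδ : l1 (fun ω => μbs ω - μzs ω) ≤ δ) :
    2 * (z - b) ^ 2 - (δ / 2) * Real.log ((z * (1 - b)) / (b * (1 - z))) ≤
      valf E F b - valf E F z := by
  have vb : valf E F b = F μbs + klb (margE E μbs) b := by
    apply IsLeast.csInf_eq
    refine ⟨⟨μbs, hμbmem, rfl⟩, ?_⟩
    rintro _ ⟨μ, hμ, rfl⟩
    exact hμbmin μ hμ
  have vz : valf E F z = F μzs + klb (margE E μzs) z := by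
    apply IsLeast.csInf_eq
    refine ⟨⟨μzs, hμzmem, rfl⟩, ?_⟩
    rintro _ ⟨μ, hμ, rfl⟩
    exact hμzmin μ hμ
  have hq0 : 0 ≤ margE E μbs := by linarith
  have hq1 : margE E μbs ≤ 1 := by
    rw [← hμbmem.2]
    exact Finset.sum_le_sum_of_subset_of_nonneg (Finset.subset_univ E)
      (fun i _ _ => hμbmem.1 i)
  have hδ2 : 2 * (margE E μzs - margE E μbs) ≤ δ := by
    refine le_trans ?_ hδ
    have hb' := hμbmem.2
    have hz' := hμzmem.2
    rw [← Finset.sum_add_sum_compl E] at hb' hz'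
    unfold l1
    rw [← Finset.sum_add_sum_compl E]
    have h1 : ∑ ω ∈ E, (μzs ω - μbs ω) ≤ ∑ ω ∈ E, |μbs ω - μzs ω| :=
      Finset.sum_le_sum (fun i _ => by rw [abs_sub_comm]; exact le_abs_self _)
    have h2 : ∑ ω ∈ Eᶜ, (μbs ω - μzs ω) ≤ ∑ ω ∈ Eᶜ, |μbs ω - μzs ω| :=
      Finset.sum_le_sum (fun i _ => le_abs_self _)
    rw [Finset.sum_sub_distrib] at h1 h2
    unfold margE
    linarith
  have hz0 : 0 < z := hb.trans hbz
  have hb1 : b < 1 := hbz.trans hz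
  have hd := klb_diff_aux (margE E μbs) b z hq0 hq1 hb hb1 hz0 hz
  have hp := pinsker_aux b z hb hbz hz
  have hm := hμzmin μbs hμbmem
  have hL1 : 0 < Real.log z - Real.log b := sub_pos.2 (Real.log_lt_log hb hbz)
  have hL2 : 0 < Real.log (1 - b) - Real.log (1 - z) :=
    sub_pos.2 (Real.log_lt_log (by linarith) (by linarith))
  rw [vb, vz, Real.log_div (mul_pos hz0 (sub_pos.2 hb1)).ne' (mul_pos hb (sub_pos.2 hz)).ne',
    Real.log_mul hz0.ne' (sub_pos.2 hb1).ne', Real.log_mul hb.ne' (sub_pos.2 hz).ne']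
  have hq : 0 ≤ margE E μbs - z + δ / 2 := by linarith
  have := mul_nonneg hq (add_pos hL1 hL2).le
  nlinarith [this]

end Statement16
end

section
/- Let gamma > 0 and let F : Delta → ℝ be gamma-strongly convex with respect to the ℓ1 norm and be the restriction of a differentiable function on an open neighborhood of Delta in ℝ^Omega, and suppose E is nonempty with E ≠ Omega. Let 0 < b < z < 1, let mu_b* minimize mu ↦ F(mu) + kl(mu(E)‖b) over Delta and mu_z* minimize mu ↦ F(mu) + kl(mu(E)‖z) over Delta, with mu_z* having all coordinates strictly positive; set m_b := mu_b*(E) and m_z := mu_z*(E) and assume m_b >= b and z <= m_z < 1. Suppose further that the value function f is differentiable at z with f'(z) <= 0, and let k > 0 satisfy |log( (z·(1−b)) / (b·(1−z)) )| <= k. Then f(b) − f(z) >= (k²/(32·gamma))·( log( 1 + (16·gamma/k²)·(z − b)² ) )². -/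
open Finset

section Statement17

variable {Ω : Type} [Fintype Ω] [Nonempty Ω] [DecidableEq Ω]

lemma aux_pinsker (q p : ℝ) (hp : 0 < p) (hpq : p ≤ q) (hq : q < 1) :
    2 * (q - p) ^ 2 ≤ klb q p := by
  have hanti : AntitoneOn (fun p : ℝ => q * (Real.log q - Real.log p)
      + (1 - q) * (Real.log (1 - q) - Real.log (1 - p)) - 2 * (q - p) ^ 2) (Set.Icc p q) := by
    have hd : ∀ x ∈ Set.Icc p q, HasDerivAt (fun p : ℝ => q * (Real.log q - Real.log p)
      + (1 - q) * (Real.log (1 - q) - Real.log (1 - p)) - 2 * (q - p) ^ 2)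
      (q * (0 - 1 / x) + (1 - q) * (0 - (-1) / (1 - x))
        - 2 * ((2 : ℕ) * (q - x) ^ (2 - 1) * (-1))) x := by
      intro x hx
      have hx0 : x ≠ 0 := by have := hx.1; linarith
      have hx1 : 1 - x ≠ 0 := by have := hx.2; linarith
      have h1 := ((hasDerivAt_const x (Real.log q)).sub ((hasDerivAt_id x).log hx0)).const_mul q
      have h2 := ((hasDerivAt_const x (Real.log (1 - q))).sub
        (((hasDerivAt_id x).const_sub 1).log hx1)).const_mul (1 - q)
      have h3 := ((((hasDerivAt_id x).const_sub q)).pow 2).const_mul 2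
      exact (h1.add h2).sub h3
    apply antitoneOn_of_deriv_nonpos (convex_Icc p q)
    · exact fun x hx => (hd x hx).continuousAt.continuousWithinAt
    · exact fun x hx => (hd x (interior_subset hx)).differentiableAt.differentiableWithinAt
    · intro x hx
      have hx := interior_subset hx
      rw [(hd x hx).deriv]
      have hx0 : 0 < x := by have := hx.1; linarith
      have hx1 : 0 < 1 - x := by have := hx.2; linarith
      have : q * (0 - 1 / x) + (1 - q) * (0 - (-1) / (1 - x))
        - 2 * ((2 : ℕ) * (q - x) ^ (2 - 1) * (-1))
        = - ((q - x) * (1 - 2 * x) ^ 2 / (x * (1 - x))) := by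
        field_simp
        push_cast
        ring
      rw [this]
      have : 0 ≤ q - x := by have := hx.2; linarith
      have : 0 ≤ (q - x) * (1 - 2 * x) ^ 2 / (x * (1 - x)) := by positivity
      linarith
  have h := hanti (Set.left_mem_Icc.2 hpq) (Set.right_mem_Icc.2 hpq) hpq
  simp only [sub_self] at h
  unfold klb
  rw [Real.log_div (by linarith) (by linarith), Real.log_div (by linarith) (by linarith)]
  norm_num at h
  linarith

lemma aux_logit (p q : ℝ) (hp : 0 < p) (hpq : p ≤ q) (hq : q < 1) :
    4 * (q - p) ≤ (Real.log q - Real.log (1 - q)) - (Real.log p - Real.log (1 - p)) := by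
  have hm : MonotoneOn (fun p : ℝ => Real.log p - Real.log (1 - p) - 4 * p) (Set.Icc p q) := by
    have hd : ∀ x ∈ Set.Icc p q, HasDerivAt
      (fun p : ℝ => Real.log p - Real.log (1 - p) - 4 * p)
      (1 / x - (-1) / (1 - x) - 4 * 1) x := by
      intro x hx
      have hx0 : x ≠ 0 := by have := hx.1; linarith
      have hx1 : 1 - x ≠ 0 := by have := hx.2; linarith
      exact (((hasDerivAt_id x).log hx0).sub
        (((hasDerivAt_id x).const_sub 1).log hx1)).sub ((hasDerivAt_id x).const_mul 4)
    apply monotoneOn_of_deriv_nonneg (convex_Icc p q)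
    · exact fun x hx => (hd x hx).continuousAt.continuousWithinAt
    · exact fun x hx => (hd x (interior_subset hx)).differentiableAt.differentiableWithinAt
    · intro x hx
      have hx := interior_subset hx
      rw [(hd x hx).deriv]
      have hx0 : 0 < x := by have := hx.1; linarith
      have hx1 : 0 < 1 - x := by have := hx.2; linarith
      have : 1 / x - (-1) / (1 - x) - 4 * 1 = (1 - 2 * x) ^ 2 / (x * (1 - x)) := by
        field_simp
        ring
      rw [this]
      positivity
  have h := hm (Set.left_mem_Icc.2 hpq) (Set.right_mem_Icc.2 hpq) hpq
  simp only at h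
  linarith

lemma aux_log (x : ℝ) (hx : 0 ≤ x) : (Real.log (1 + x)) ^ 2 ≤ 2 * x := by
  obtain ⟨w, hw1, hw⟩ : ∃ w : ℝ, 1 ≤ w ∧ w ^ 4 = 1 + x := by
    refine ⟨Real.sqrt (Real.sqrt (1 + x)), ?_, ?_⟩
    · rw [Real.one_le_sqrt, Real.one_le_sqrt]; linarith
    · rw [show (4 : ℕ) = 2 * 2 from rfl, pow_mul, Real.sq_sqrt (Real.sqrt_nonneg _),
        Real.sq_sqrt (by linarith)]
  have h0 : 0 ≤ Real.log (1 + x) := Real.log_nonneg (by linarith)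
  have h1 : Real.log (1 + x) ≤ 4 * (w - 1) := by
    rw [← hw, Real.log_pow]
    have := Real.log_le_sub_one_of_pos (show 0 < w by linarith)
    push_cast
    linarith
  have h2 : (Real.log (1 + x)) ^ 2 ≤ (4 * (w - 1)) ^ 2 := by gcongr
  have h3 : 2 * x - (4 * (w - 1)) ^ 2 = 2 * (w - 1) * (w ^ 3 + w ^ 2 - 7 * w + 9) := by
    have : x = w ^ 4 - 1 := by linarith
    rw [this]; ring
  have h4 : 0 ≤ w ^ 3 + w ^ 2 - 7 * w + 9 := by
    nlinarith [mul_nonneg (sub_nonneg.2 hw1) (sq_nonneg (w - 3 / 2)), sq_nonneg (w - 3 / 2)]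
  have h5 : 0 ≤ 2 * (w - 1) * (w ^ 3 + w ^ 2 - 7 * w + 9) :=
    mul_nonneg (by linarith) h4
  linarith

lemma aux_rhs (γ k d : ℝ) (hγ : 0 < γ) (hk : 0 < k) (hd : 0 < d) (hkd : 4 * d ≤ k) :
    (k ^ 2 / (32 * γ)) * (Real.log (1 + (16 * γ / k ^ 2) * d ^ 2)) ^ 2 ≤ d ^ 2 ∧
    (k ^ 2 / (32 * γ)) * (Real.log (1 + (16 * γ / k ^ 2) * d ^ 2)) ^ 2 ≤ γ * d ^ 2 := by
  set x := (16 * γ / k ^ 2) * d ^ 2 with hx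
  have hx0 : 0 ≤ x := by positivity
  have hc : 0 ≤ k ^ 2 / (32 * γ) := by positivity
  constructor
  · calc _ ≤ (k ^ 2 / (32 * γ)) * (2 * x) := by gcongr; exact aux_log x hx0
      _ = d ^ 2 := by rw [hx]; field_simp; norm_num
  · have h0 : 0 ≤ Real.log (1 + x) := Real.log_nonneg (by linarith)
    have h1 : Real.log (1 + x) ≤ x := by
      have := Real.log_le_sub_one_of_pos (show 0 < 1 + x by linarith)
      linarith
    calc _ ≤ (k ^ 2 / (32 * γ)) * x ^ 2 := by gcongr
      _ = 8 * γ * d ^ 4 / k ^ 2 := by rw [hx]; field_simp; norm_num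
      _ ≤ γ * d ^ 2 := by
        rw [div_le_iff₀ (by positivity)]
        have : (4 * d) ^ 2 ≤ k ^ 2 := by gcongr
        nlinarith [mul_nonneg (mul_nonneg hγ.le (sq_nonneg d)) (sub_nonneg.2 this), 
          mul_nonneg hγ.le (sq_nonneg (d ^ 2))]

lemma aux_chi (q p : ℝ) (hp : 0 < p) (hp1 : p < 1) (hq : 0 < q) (hq1 : q < 1) :
    klb q p ≤ (q - p) ^ 2 / (p * (1 - p)) := by
  have hp' : 0 < 1 - p := by linarith
  have hq' : 0 < 1 - q := by linarith
  have h1 := Real.log_le_sub_one_of_pos (show 0 < q / p by positivity)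
  have h2 := Real.log_le_sub_one_of_pos (show 0 < (1 - q) / (1 - p) by positivity)
  calc klb q p ≤ q * (q / p - 1) + (1 - q) * ((1 - q) / (1 - p) - 1) := by
        unfold klb; gcongr
    _ = (q - p) ^ 2 / (p * (1 - p)) := by field_simp; ring

lemma aux_l1 (E : Finset Ω) (μ ν : Ω → ℝ) (hμ : μ ∈ Delta Ω) (hν : ν ∈ Delta Ω) :
    4 * (margE E μ - margE E ν) ^ 2 ≤ (l1 (fun ω => μ ω - ν ω)) ^ 2 := by
  have hs : ∑ ω ∈ E, (μ ω - ν ω) = margE E μ - margE E ν := by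
    simp [margE, Finset.sum_sub_distrib]
  have hc : ∑ ω ∈ Eᶜ, (μ ω - ν ω) = -(margE E μ - margE E ν) := by
    have h := Finset.sum_add_sum_compl E (fun ω => μ ω - ν ω)
    rw [Finset.sum_sub_distrib (s := univ), hμ.2, hν.2, hs] at h
    linarith
  have h1 := Finset.abs_sum_le_sum_abs (fun ω => μ ω - ν ω) E
  have h2 := Finset.abs_sum_le_sum_abs (fun ω => μ ω - ν ω) Eᶜ
  rw [hs] at h1
  rw [hc, abs_neg] at h2
  have h3 : 2 * |margE E μ - margE E ν| ≤ l1 (fun ω => μ ω - ν ω) := by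
    unfold l1
    rw [← Finset.sum_add_sum_compl E (fun ω => |μ ω - ν ω|)]
    linarith
  calc 4 * (margE E μ - margE E ν) ^ 2 = (2 * |margE E μ - margE E ν|) ^ 2 := by
        rw [mul_pow, sq_abs]; norm_num
    _ ≤ _ := by gcongr

lemma aux_margE_le (E : Finset Ω) (μ : Ω → ℝ) (hμ : μ ∈ Delta Ω) : margE E μ ≤ 1 := by
  rw [← hμ.2]
  exact Finset.sum_le_sum_of_subset_of_nonneg (Finset.subset_univ _) (fun i _ _ => hμ.1 i)

lemma aux_valf (E : Finset Ω) (F : (Ω → ℝ) → ℝ) (p : ℝ) (ν : Ω → ℝ) (hν : ν ∈ Delta Ω)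
    (hmin : ∀ μ ∈ Delta Ω, F ν + klb (margE E ν) p ≤ F μ + klb (margE E μ) p) :
    valf E F p = F ν + klb (margE E ν) p := by
  apply IsLeast.csInf_eq
  refine ⟨⟨ν, hν, rfl⟩, ?_⟩
  rintro _ ⟨μ, hμ, rfl⟩
  exact hmin μ hμ

/-- Comparison of the `z`-minimizer with a convex combination. -/
lemma aux_step (E : Finset Ω) (γ : ℝ) (hγ : 0 < γ)
    (F : (Ω → ℝ) → ℝ) (hsc : StrongConvexL1 γ F) (z : ℝ)
    (μb μz : Ω → ℝ) (hb : μb ∈ Delta Ω) (hz : μz ∈ Delta Ω)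
    (hmin : ∀ μ ∈ Delta Ω, F μz + klb (margE E μz) z ≤ F μ + klb (margE E μ) z)
    (s : ℝ) (hs0 : 0 ≤ s) (hs1 : s ≤ 1) :
    F μz + klb (margE E μz) z + 2 * γ * s * (1 - s) * (margE E μz - margE E μb) ^ 2 ≤
      (1 - s) * F μz + s * F μb + klb ((1 - s) * margE E μz + s * margE E μb) z := by
  have h1 := hsc μz hz μb hb s hs0 hs1
  have hmem : (fun ω => (1 - s) * μz ω + s * μb ω) ∈ Delta Ω := by
    constructor
    · intro ω
      have := hz.1 ω
      have := hb.1 ω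
      have : 0 ≤ 1 - s := by linarith
      positivity
    · rw [Finset.sum_add_distrib, ← Finset.mul_sum, ← Finset.mul_sum, hz.2, hb.2]
      ring
  have h2 := hmin _ hmem
  have h3 : margE E (fun ω => (1 - s) * μz ω + s * μb ω)
      = (1 - s) * margE E μz + s * margE E μb := by
    simp only [margE]
    rw [Finset.sum_add_distrib, ← Finset.mul_sum, ← Finset.mul_sum]
  rw [h3] at h2
  have h4 := aux_l1 E μz μb hz hb
  have h5 : 0 ≤ (γ / 2) * s * (1 - s) :=
    mul_nonneg (by positivity) (by linarith)
  nlinarith [mul_le_mul_of_nonneg_left h4 h5]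

lemma aux_klb_self (z : ℝ) (hz : 0 < z) (hz1 : z < 1) : klb z z = 0 := by
  unfold klb
  rw [div_self hz.ne', div_self (by linarith)]
  simp

/-- The main gap bound when the marginal `a` of the `b`-minimizer is below `z`. -/
lemma aux_gap (E : Finset Ω) (γ : ℝ) (hγ : 0 < γ)
    (F : (Ω → ℝ) → ℝ) (hsc : StrongConvexL1 γ F) (z : ℝ) (hz0 : 0 < z) (hz1 : z < 1)
    (μb μz : Ω → ℝ) (hb : μb ∈ Delta Ω) (hz : μz ∈ Delta Ω)
    (hmin : ∀ μ ∈ Delta Ω, F μz + klb (margE E μz) z ≤ F μ + klb (margE E μ) z)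
    (ha0 : 0 < margE E μb) (haz : margE E μb < z) (hmz : z ≤ margE E μz)
    (hmz1 : margE E μz < 1) :
    F μz + klb (margE E μz) z + 2 * γ * (z - margE E μb) ^ 2 ≤ F μb := by
  have key := aux_step E γ hγ F hsc z μb μz hb hz hmin
  set a := margE E μb
  set m := margE E μz
  rcases hmz.eq_or_lt with h | h
  · rw [← h, aux_klb_self z hz0 hz1] at key ⊢
    set C := (a - z) ^ 2 / (z * (1 - z)) with hC
    have hC0 : 0 ≤ C := by
      have : 0 < 1 - z := by linarith
      positivity
    have hl : ∀ s : ℝ, 0 < s → s < 1 →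
        2 * γ * (z - a) ^ 2 ≤ F μb - F μz + s * (C + 2 * γ * (z - a) ^ 2) := by
      intro s hs0 hs1
      have h1 := key s hs0.le hs1.le
      have hq0 : 0 < (1 - s) * z + s * a := by
        have : 0 < 1 - s := by linarith
        positivity
      have hq1 : (1 - s) * z + s * a < 1 := by nlinarith
      have h2 := aux_chi _ z hz0 hz1 hq0 hq1
      have h3 : ((1 - s) * z + s * a - z) ^ 2 / (z * (1 - z)) = s ^ 2 * C := by
        rw [hC]; ring
      rw [h3] at h2
      have h4 : s * (2 * γ * (z - a) ^ 2) ≤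
          s * (F μb - F μz + s * (C + 2 * γ * (z - a) ^ 2)) := by nlinarith
      exact le_of_mul_le_mul_left h4 hs0
    by_contra hcon
    push Not at hcon
    set D := C + 2 * γ * (z - a) ^ 2 with hD
    have hD0 : 0 ≤ D := by positivity
    set e := F μz + 0 + 2 * γ * (z - a) ^ 2 - F μb with he
    have he0 : 0 < e := by linarith
    have h1 := hl (e / (2 * (D + e))) (by positivity)
      (by rw [div_lt_one (by positivity)]; linarith)
    have h2 : e / (2 * (D + e)) * D ≤ e / 2 := by
      rw [div_mul_eq_mul_div, div_le_div_iff₀ (by positivity) (by norm_num)]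
      nlinarith [mul_pos he0 he0]
    linarith
  · have hma : 0 < m - a := by linarith
    set s := (m - z) / (m - a) with hs
    have hs0 : 0 < s := div_pos (by linarith) hma
    have hs1 : s ≤ 1 := by rw [hs, div_le_one hma]; linarith
    have h1 := key s hs0.le hs1
    have hsm : s * (m - a) = m - z := by rw [hs]; field_simp
    have h2 : (1 - s) * m + s * a = z := by linarith
    rw [h2, aux_klb_self z hz0 hz1] at h1
    have hkl : 0 ≤ klb m z := le_trans (by positivity) (aux_pinsker m z hz0 hmz hmz1)
    have h3 : (1 - s) * (m - a) = z - a := by linarith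
    have h4 : (z - a) ^ 2 ≤ (1 - s) * (m - a) ^ 2 := by
      have : (1 - s) * (m - a) ^ 2 = (z - a) * (m - a) := by rw [← h3]; ring
      rw [this]; nlinarith
    have h5 : s * klb m z ≤ klb m z := by nlinarith
    have h6 : s * (2 * γ * (z - a) ^ 2) ≤ s * (2 * γ * ((1 - s) * (m - a) ^ 2)) := by gcongr
    have h7 : s * (F μz + klb m z + 2 * γ * (z - a) ^ 2) ≤ s * F μb := by nlinarith
    exact le_of_mul_le_mul_left h7 hs0

/-- Combining the strong-convexity and gradient bounds: if additionally `F` is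
`γ`-strongly convex, `f` is differentiable at `z` with `f'(z) ≤ 0`, and
`|log( z(1−b) / (b(1−z)) )| ≤ k`, then
`f(b) − f(z) ≥ (k²/(32γ))·log²( 1 + (16γ/k²)(z−b)² )`. -/
theorem stmt17 (E : Finset Ω) (hE : E.Nonempty) (hEuniv : E ≠ univ)
    (γ : ℝ) (hγ : 0 < γ)
    (F : (Ω → ℝ) → ℝ) (hsc : StrongConvexL1 γ F)
    (hsmooth : ∃ U : Set (Ω → ℝ), IsOpen U ∧ Delta Ω ⊆ U ∧ DifferentiableOn ℝ F U)
    (b z : ℝ) (hb : 0 < b) (hbz : b < z) (hz : z < 1)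
    (μbs μzs : Ω → ℝ) (hμbmem : μbs ∈ Delta Ω) (hμzmem : μzs ∈ Delta Ω)
    (hμbmin : ∀ μ ∈ Delta Ω, F μbs + klb (margE E μbs) b ≤ F μ + klb (margE E μ) b)
    (hμzmin : ∀ μ ∈ Delta Ω, F μzs + klb (margE E μzs) z ≤ F μ + klb (margE E μ) z)
    (hμzpos : ∀ ω, 0 < μzs ω)
    (hmb : b ≤ margE E μbs) (hmz : z ≤ margE E μzs) (hmz1 : margE E μzs < 1)
    (dz : ℝ) (hdz : HasDerivAt (valf E F) dz z) (hdz0 : dz ≤ 0)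
    (k : ℝ) (hk : 0 < k) (hklog : |Real.log ((z * (1 - b)) / (b * (1 - z)))| ≤ k) :
    (k ^ 2 / (32 * γ)) * (Real.log (1 + (16 * γ / k ^ 2) * (z - b) ^ 2)) ^ 2 ≤
      valf E F b - valf E F z := by
  have hb1 : b < 1 := by linarith
  have hz0 : 0 < z := by linarith
  have hlogit : Real.log ((z * (1 - b)) / (b * (1 - z)))
      = (Real.log z - Real.log (1 - z)) - (Real.log b - Real.log (1 - b)) := by
    rw [Real.log_div (by nlinarith) (by nlinarith), Real.log_mul (by linarith) (by linarith),
      Real.log_mul (by linarith) (by linarith)]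
    ring
  have h4 := aux_logit b z hb hbz.le hz
  have hkd : 4 * (z - b) ≤ k := by
    have := le_trans (le_abs_self _) hklog
    linarith
  obtain ⟨hR1, hR2⟩ := aux_rhs γ k (z - b) hγ hk (by linarith) hkd
  set R := (k ^ 2 / (32 * γ)) * (Real.log (1 + (16 * γ / k ^ 2) * (z - b) ^ 2)) ^ 2
  rw [aux_valf E F b μbs hμbmem hμbmin, aux_valf E F z μzs hμzmem hμzmin]
  have ha1 := aux_margE_le E μbs hμbmem
  rcases lt_or_ge (margE E μbs) z with haz | haz
  · have hg := aux_gap E γ hγ F hsc z hz0 hz μbs μzs hμbmem hμzmem hμzmin (by linarith) haz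
      hmz hmz1
    have hp := aux_pinsker (margE E μbs) b hb hmb (by linarith)
    set a := margE E μbs
    -- combine: 2 (a-b)^2 + 2 γ (z-a)^2 ≥ min 1 γ * (z-b)^2
    have hsq : (z - b) ^ 2 ≤ 2 * (a - b) ^ 2 + 2 * (z - a) ^ 2 := by
      nlinarith [sq_nonneg ((a - b) - (z - a))]
    have : R ≤ 2 * (a - b) ^ 2 + 2 * γ * (z - a) ^ 2 := by
      rcases le_total γ 1 with hg1 | hg1
      · nlinarith [mul_le_mul_of_nonneg_left hsq hγ.le, sq_nonneg (a - b)]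
      · nlinarith [sq_nonneg (z - a)]
    linarith
  · have hg := hμzmin μbs hμbmem
    have hp := aux_pinsker z b hb hbz.le hz
    set a := margE E μbs
    have ha0 : 0 < a := by linarith
    have hdiff : klb a b - klb a z = klb z b + (a - z) *
        ((Real.log z - Real.log (1 - z)) - (Real.log b - Real.log (1 - b))) := by
      have e1 : ∀ p : ℝ, 0 < p → p < 1 →
          klb a p = a * Real.log a + (1 - a) * Real.log (1 - a)
            - a * Real.log p - (1 - a) * Real.log (1 - p) := by
        intro p hp0 hp1
        unfold klb
        rw [Real.log_div ha0.ne' hp0.ne']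
        rcases ha1.eq_or_lt with h | h
        · rw [h]; ring
        · rw [Real.log_div (by linarith) (by linarith)]; ring
      rw [e1 b hb hb1, e1 z hz0 hz]
      unfold klb
      rw [Real.log_div hz0.ne' hb.ne', Real.log_div (by linarith) (by linarith)]
      ring
    have : 0 ≤ (a - z) *
        ((Real.log z - Real.log (1 - z)) - (Real.log b - Real.log (1 - b))) :=
      mul_nonneg (by linarith) (by linarith)
    nlinarith [sq_nonneg (z - b)]

end Statement17
end
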